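/- Strong-type Rubio de Francia extrapolation: let $1<p_0<\infty$ and suppose $f,g\ge0$ satisfy $\|g\|_{L^{p_0}(w)}\le C_w\|f\|_{L^{p_0}(w)}$ for every $w\in A_{p_0}$, with $C_w$ depending only on $\|w\|_{A_{p_0}}$. Then for every $1<p<\infty$ and every $w\in A_p$, $\|g\|_{L^p(w)}\le C'_w\|f\|_{L^p(w)}$ with $C'_w$ depending only on $\|w\|_{A_p}$. -/

import Mathlib

open MeasureTheory ENNReal Set

noncomputable section

/-- An axis-parallel cube in `ℝⁿ`. -/
def IsCube {n : ℕ} (Q : Set (Fin n → ℝ)) : Prop :=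
  ∃ (a : Fin n → ℝ) (r : ℝ), 0 < r ∧ Q = Set.Icc a (fun i => a i + r)

/-- Average of `w` over a set `Q` (w.r.t. Lebesgue measure). -/
def cubeAvg {n : ℕ} (w : (Fin n → ℝ) → ℝ≥0∞) (Q : Set (Fin n → ℝ)) : ℝ≥0∞ :=
  (∫⁻ x in Q, w x) / volume Q

/-- Hardy–Littlewood maximal operator (over cubes containing the point). -/
def maxOp {n : ℕ} (f : (Fin n → ℝ) → ℝ≥0∞) (x : Fin n → ℝ) : ℝ≥0∞ :=
  ⨆ (Q : Set (Fin n → ℝ)) (_ : IsCube Q) (_ : x ∈ Q), cubeAvg f Q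

/-- `M_μ f = (M(f^{1/μ}))^μ`. -/
def maxOpP {n : ℕ} (μ : ℝ) (f : (Fin n → ℝ) → ℝ≥0∞) (x : Fin n → ℝ) : ℝ≥0∞ :=
  (maxOp (fun y => f y ^ (1 / μ)) x) ^ μ

/-- Muckenhoupt `A_p` constant; for `p = 1` the least `C` with `Mw ≤ C w` a.e. -/
def apConst {n : ℕ} (p : ℝ) (w : (Fin n → ℝ) → ℝ≥0∞) : ℝ≥0∞ :=
  if p = 1 then
    sInf {C : ℝ≥0∞ | ∀ᵐ x ∂(volume : Measure (Fin n → ℝ)), maxOp w x ≤ C * w x}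
  else
    ⨆ (Q : Set (Fin n → ℝ)) (_ : IsCube Q),
      cubeAvg w Q * (cubeAvg (fun x => w x ^ (-1 / (p - 1))) Q) ^ (p - 1)

/-- `A_∞` "constant": infimum of the `A_p` constants over `p > 1`. -/
def ainfConst {n : ℕ} (w : (Fin n → ℝ) → ℝ≥0∞) : ℝ≥0∞ :=
  ⨅ (p : ℝ) (_ : 1 < p), apConst p w

/-- `u(E) = ∫_E u`. -/
def wMeas {n : ℕ} (w : (Fin n → ℝ) → ℝ≥0∞) (E : Set (Fin n → ℝ)) : ℝ≥0∞ :=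
  ∫⁻ x in E, w x

/-- `‖g‖_{L^{p,∞}(w)} = sup_y y · w({g>y})^{1/p}`. -/
def wkNorm {n : ℕ} (p : ℝ) (w g : (Fin n → ℝ) → ℝ≥0∞) : ℝ≥0∞ :=
  ⨆ y : ℝ≥0∞, y * (wMeas w {x | y < g x}) ^ (1 / p)

/-- `‖f‖_{L^p(w)}`. -/
def stNorm {n : ℕ} (p : ℝ) (w f : (Fin n → ℝ) → ℝ≥0∞) : ℝ≥0∞ :=
  (∫⁻ x, f x ^ p * w x) ^ (1 / p)

/-- A locally bounded function `φ : [0,∞] → [0,∞]`. -/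
def LocBdd (φ : ℝ≥0∞ → ℝ≥0∞) : Prop :=
  ∀ M : ℝ≥0∞, M ≠ ⊤ → ∃ C : ℝ≥0∞, C ≠ ⊤ ∧ ∀ t ≤ M, φ t ≤ C

/-- A (a.e.) positive, locally integrable weight. -/
def PosLocInt {n : ℕ} (u : (Fin n → ℝ) → ℝ≥0∞) : Prop :=
  Measurable u ∧ (∀ᵐ x ∂(volume : Measure (Fin n → ℝ)), 0 < u x) ∧
    ∀ Q : Set (Fin n → ℝ), IsCube Q → (∫⁻ x in Q, u x) < ⊤

end

noncomputable section

lemma rdf_layer_fin {q : ℝ} (hq : 0 < q) {a : ℝ} (ha : 0 ≤ a) :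
    ∫⁻ t in Ioi (0:ℝ), (if ENNReal.ofReal t < ENNReal.ofReal a then ENNReal.ofReal (t ^ (q-1)) else 0)
      = ENNReal.ofReal a ^ q / ENNReal.ofReal q := by
  have h1 : ∫⁻ t in Ioi (0:ℝ), (if ENNReal.ofReal t < ENNReal.ofReal a then ENNReal.ofReal (t ^ (q-1)) else 0)
      = ∫⁻ t in Ioi (0:ℝ), (Iio a).indicator (fun t => ENNReal.ofReal (t ^ (q-1))) t := by
    refine setLIntegral_congr_fun measurableSet_Ioi ?_
    intro t ht
    simp only [indicator, mem_Iio]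
    have : ENNReal.ofReal t < ENNReal.ofReal a ↔ t < a := by
      rw [ENNReal.ofReal_lt_ofReal_iff']
      constructor
      · exact fun h => h.1
      · exact fun h => ⟨h, lt_trans ht h⟩
    simp only [this]
  rw [h1, setLIntegral_indicator measurableSet_Iio]
  have h2 : Iio a ∩ Ioi 0 = Ioo 0 a := by ext; simp [and_comm]
  rw [h2, restrict_Ioo_eq_restrict_Ioc]
  have hInt : IntervalIntegrable (fun t : ℝ => t ^ (q-1)) volume 0 a :=
    intervalIntegral.intervalIntegrable_rpow' (by linarith)
  rw [← ofReal_integral_eq_lintegral_ofReal]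
  · rw [← intervalIntegral.integral_of_le ha, integral_rpow (Or.inl (by linarith))]
    rw [sub_add_cancel, Real.zero_rpow hq.ne', sub_zero, ENNReal.ofReal_div_of_pos hq,
      ENNReal.ofReal_rpow_of_nonneg ha hq.le]
  · exact (intervalIntegrable_iff_integrableOn_Ioc_of_le ha).1 hInt
  · refine (ae_restrict_iff' measurableSet_Ioc).2 (Filter.Eventually.of_forall ?_)
    intro t ht
    exact Real.rpow_nonneg ht.1.le _

lemma rdf_layer {q : ℝ} (hq : 0 < q) (y : ℝ≥0∞) :
    ∫⁻ t in Ioi (0:ℝ), (if ENNReal.ofReal t < y then ENNReal.ofReal (t ^ (q-1)) else 0)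
      = y ^ q / ENNReal.ofReal q := by
  by_cases hy : y = ⊤
  · subst hy
    rw [ENNReal.top_rpow_of_pos hq, ENNReal.top_div_of_ne_top ENNReal.ofReal_ne_top]
    rw [eq_top_iff]
    refine ENNReal.le_of_forall_nnreal_lt ?_
    intro r _
    have hb : (r : ℝ≥0∞) = ENNReal.ofReal ((r * q) ^ (1/q)) ^ q / ENNReal.ofReal q := by
      have h0 : (0:ℝ) ≤ r * q := mul_nonneg r.2 hq.le
      rw [ENNReal.ofReal_rpow_of_nonneg (Real.rpow_nonneg h0 _) hq.le, ← Real.rpow_mul h0,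
        one_div_mul_cancel hq.ne', Real.rpow_one, ← ENNReal.ofReal_div_of_pos hq,
        mul_div_cancel_right₀ _ hq.ne', ENNReal.ofReal_coe_nnreal]
    have hb2 := rdf_layer_fin hq (a := ((r:ℝ) * q) ^ (1/q)) (Real.rpow_nonneg (mul_nonneg r.2 hq.le) _)
    rw [hb, ← hb2]
    refine lintegral_mono ?_
    intro t
    dsimp only
    split_ifs with h1 h2
    · exact le_rfl
    · exact absurd ENNReal.ofReal_lt_top h2
    · exact zero_le
    · exact le_rfl
  · have := rdf_layer_fin hq (a := y.toReal) ENNReal.toReal_nonneg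
    rwa [ENNReal.ofReal_toReal hy] at this

/-- Maximal operator over closed balls (cubes) w.r.t. a measure. -/
def rdfM {n : ℕ} (ν : Measure (Fin n → ℝ)) (f : (Fin n → ℝ) → ℝ≥0∞) (x : Fin n → ℝ) : ℝ≥0∞ :=
  ⨆ (c : Fin n → ℝ) (r : ℝ) (_ : 0 < r) (_ : x ∈ Metric.closedBall c r),
    (∫⁻ y in Metric.closedBall c r, f y ∂ν) / ν (Metric.closedBall c r)

lemma rdf_cube_iff {n : ℕ} (Q : Set (Fin n → ℝ)) :
    IsCube Q ↔ ∃ (c : Fin n → ℝ) (r : ℝ), 0 < r ∧ Q = Metric.closedBall c r := by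
  have key : ∀ (c : Fin n → ℝ) (r : ℝ), 0 < r →
      Metric.closedBall c r = Icc (fun i => c i - r) (fun i => c i + r) := by
    intro c r hr
    rw [closedBall_pi _ hr.le, ← Set.pi_univ_Icc]
    simp only [Real.closedBall_eq_Icc]
  constructor
  · rintro ⟨a, r, hr, rfl⟩
    refine ⟨fun i => a i + r/2, r/2, by linarith, ?_⟩
    rw [key _ _ (by linarith)]
    congr 1 <;> ext i <;> ring
  · rintro ⟨c, r, hr, rfl⟩
    refine ⟨fun i => c i - r, 2*r, by linarith, ?_⟩
    rw [key _ _ hr]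
    congr 1; ext i; ring

lemma rdf_maxOp_eq {n : ℕ} (f : (Fin n → ℝ) → ℝ≥0∞) : maxOp f = rdfM volume f := by
  ext x
  unfold maxOp rdfM cubeAvg
  apply le_antisymm
  · refine iSup_le fun Q => iSup_le fun hQ => iSup_le fun hx => ?_
    obtain ⟨c, r, hr, rfl⟩ := (rdf_cube_iff Q).1 hQ
    exact le_iSup_of_le c (le_iSup_of_le r (le_iSup_of_le hr (le_iSup_of_le hx le_rfl)))
  · refine iSup_le fun c => iSup_le fun r => iSup_le fun hr => iSup_le fun hx => ?_
    exact le_iSup_of_le _ (le_iSup_of_le ((rdf_cube_iff _).2 ⟨c, r, hr, rfl⟩)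
      (le_iSup_of_le hx le_rfl))

lemma rdf_le_M {n : ℕ} (ν : Measure (Fin n → ℝ)) (f : (Fin n → ℝ) → ℝ≥0∞) {x c : Fin n → ℝ}
    {r : ℝ} (hr : 0 < r) (hx : x ∈ Metric.closedBall c r) :
    (∫⁻ y in Metric.closedBall c r, f y ∂ν) / ν (Metric.closedBall c r) ≤ rdfM ν f x :=
  le_iSup_of_le c (le_iSup_of_le r (le_iSup_of_le hr (le_iSup_of_le hx le_rfl)))

lemma rdf_lt_M {n : ℕ} {ν : Measure (Fin n → ℝ)} {f : (Fin n → ℝ) → ℝ≥0∞} {x : Fin n → ℝ}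
    {t : ℝ≥0∞} : t < rdfM ν f x ↔ ∃ (c : Fin n → ℝ) (r : ℝ), 0 < r ∧ x ∈ Metric.closedBall c r ∧
      t < (∫⁻ y in Metric.closedBall c r, f y ∂ν) / ν (Metric.closedBall c r) := by
  unfold rdfM
  simp only [lt_iSup_iff, exists_prop]

structure rdfReg {n : ℕ} (ν : Measure (Fin n → ℝ)) : Prop where
  pos : ∀ (c : Fin n → ℝ) (r : ℝ), 0 < r → ν (Metric.closedBall c r) ≠ 0
  fin : ∀ (c : Fin n → ℝ) (r : ℝ), ν (Metric.closedBall c r) ≠ ⊤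

lemma rdf_reg_volume {n : ℕ} : rdfReg (volume : Measure (Fin n → ℝ)) where
  pos c r hr := (Metric.measure_closedBall_pos _ _ hr).ne'
  fin c r := measure_closedBall_lt_top.ne

lemma rdf_M_isOpen {n : ℕ} {ν : Measure (Fin n → ℝ)} (hν : rdfReg ν)
    (f : (Fin n → ℝ) → ℝ≥0∞) (t : ℝ≥0∞) : IsOpen {x | t < rdfM ν f x} := by
  rw [isOpen_iff_mem_nhds]
  intro x hx
  obtain ⟨c, r, hr, hxc, ht⟩ := rdf_lt_M.1 hx
  have h1 : t * ν (Metric.closedBall c r) < ∫⁻ y in Metric.closedBall c r, f y ∂ν :=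
    (ENNReal.lt_div_iff_mul_lt (Or.inl (hν.pos c r hr)) (Or.inl (hν.fin c r))).1 ht
  have httop : t ≠ ⊤ := ht.ne_top
  -- continuity from above
  have h2 : Filter.Tendsto (fun s => t * ν (Metric.closedBall c s)) (nhdsWithin r (Ioi r))
      (nhds (t * ν (Metric.closedBall c r))) := by
    refine ENNReal.Tendsto.const_mul ?_ (Or.inr httop)
    have := tendsto_measure_biInter_gt (μ := ν) (s := fun s => Metric.closedBall c s) (a := r)
      (fun s _ => Metric.isClosed_closedBall.measurableSet.nullMeasurableSet)
      (fun i j _ hij => Metric.closedBall_subset_closedBall hij)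
      ⟨r + 1, by linarith, hν.fin c _⟩
    have h3 : ⋂ s, ⋂ (_ : s > r), Metric.closedBall c s = Metric.closedBall c r := by
      ext y
      simp only [mem_iInter, Metric.mem_closedBall]
      exact ⟨fun h => le_of_forall_gt_imp_ge_of_dense h, fun h s hs => h.trans (le_of_lt hs)⟩
    rwa [h3] at this
  obtain ⟨s, hs1, hs2⟩ := ((h2.eventually (gt_mem_nhds h1)).and self_mem_nhdsWithin).exists
  have hs2 : r < s := hs2
  refine Filter.mem_of_superset (Metric.isOpen_ball.mem_nhds
    (show x ∈ Metric.ball c s from lt_of_le_of_lt hxc hs2)) ?_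
  intro y hy
  refine rdf_lt_M.2 ⟨c, s, hr.trans hs2, Metric.ball_subset_closedBall hy, ?_⟩
  rw [ENNReal.lt_div_iff_mul_lt (Or.inl (hν.pos c s (hr.trans hs2))) (Or.inl (hν.fin c s))]
  exact hs1.trans_le (lintegral_mono_set (Metric.closedBall_subset_closedBall hs2.le))

lemma rdf_M_meas {n : ℕ} {ν : Measure (Fin n → ℝ)} (hν : rdfReg ν)
    (f : (Fin n → ℝ) → ℝ≥0∞) : Measurable (rdfM ν f) :=
  measurable_of_Ioi fun t => (rdf_M_isOpen hν f t).measurableSet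

/-- weak type (1,1) -/
lemma rdf_weak {n : ℕ} {ν : Measure (Fin n → ℝ)} (hν : rdfReg ν) {D : ℝ≥0∞}
    (hD : ∀ c r, 0 < r → ν (Metric.closedBall c (5 * r)) ≤ D * ν (Metric.closedBall c r))
    (f : (Fin n → ℝ) → ℝ≥0∞) (t : ℝ≥0∞) :
    t * ν {x | t < rdfM ν f x} ≤ D * ∫⁻ x, f x ∂ν := by
  let I : Set ((Fin n → ℝ) × ℝ) := {i | 0 < i.2 ∧
    t * ν (Metric.closedBall i.1 i.2) ≤ ∫⁻ y in Metric.closedBall i.1 i.2, f y ∂ν}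
  let J : ℕ → Set ((Fin n → ℝ) × ℝ) := fun k => {i | i ∈ I ∧ i.2 ≤ k}
  let U : ℕ → Set (Fin n → ℝ) := fun k => ⋃ i ∈ J k, Metric.closedBall i.1 i.2
  have hU : ∀ k, t * ν (U k) ≤ D * ∫⁻ x, f x ∂ν := by
    intro k
    obtain ⟨u, hut, hdis, hcov⟩ := Vitali.exists_disjoint_subfamily_covering_enlargement_closedBall
      (J k) (fun i => i.1) (fun i => i.2) k (fun i hi => hi.2) 5 (by norm_num)
    have hcount : u.Countable := by
      refine hdis.countable_of_nonempty_interior ?_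
      intro i hi
      refine ⟨i.1, ?_⟩
      exact Metric.ball_subset_interior_closedBall (Metric.mem_ball_self (hut hi).1.1)
    have hsub : U k ⊆ ⋃ i ∈ u, Metric.closedBall i.1 (5 * i.2) := by
      intro x hx
      obtain ⟨i, hi, hxi⟩ := mem_iUnion₂.1 hx
      obtain ⟨b, hb, hib⟩ := hcov i hi
      exact mem_iUnion₂.2 ⟨b, hb, hib hxi⟩
    have := hcount.to_subtype
    calc t * ν (U k) ≤ t * ∑' i : u, ν (Metric.closedBall i.1.1 (5 * i.1.2)) := by
          gcongr
          exact (measure_mono hsub).trans (measure_biUnion_le _ hcount _)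
      _ ≤ t * ∑' i : u, D * ν (Metric.closedBall i.1.1 i.1.2) := by
          gcongr with i
          exact hD _ _ (hut i.2).1.1
      _ = D * ∑' i : u, t * ν (Metric.closedBall i.1.1 i.1.2) := by
          rw [ENNReal.tsum_mul_left, ENNReal.tsum_mul_left]; ring
      _ ≤ D * ∑' i : u, ∫⁻ y in Metric.closedBall i.1.1 i.1.2, f y ∂ν := by
          gcongr with i
          exact (hut i.2).1.2
      _ = D * ∫⁻ y in ⋃ i ∈ u, Metric.closedBall i.1 i.2, f y ∂ν := by
          rw [lintegral_biUnion hcount (fun i _ => Metric.isClosed_closedBall.measurableSet) hdis]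
      _ ≤ D * ∫⁻ x, f x ∂ν := by
          exact mul_le_mul_right (setLIntegral_le_lintegral _ _) _
  have hmono : Monotone U := by
    intro k l hkl
    refine biUnion_subset_biUnion_left ?_
    intro i hi
    exact ⟨hi.1, hi.2.trans (by exact_mod_cast hkl)⟩
  have hsub : {x | t < rdfM ν f x} ⊆ ⋃ k, U k := by
    intro x hx
    obtain ⟨c, r, hr, hxc, ht⟩ := rdf_lt_M.1 hx
    obtain ⟨k, hk⟩ := exists_nat_ge r
    refine mem_iUnion.2 ⟨k, mem_iUnion₂.2 ⟨(c, r), ⟨⟨hr, ?_⟩, hk⟩, hxc⟩⟩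
    exact ((ENNReal.lt_div_iff_mul_lt (Or.inl (hν.pos c r hr)) (Or.inl (hν.fin c r))).1 ht).le
  calc t * ν {x | t < rdfM ν f x} ≤ t * ν (⋃ k, U k) := by gcongr
    _ = ⨆ k, t * ν (U k) := by rw [hmono.measure_iUnion, ENNReal.mul_iSup]
    _ ≤ _ := iSup_le hU

/-- improved weak type bound -/
lemma rdf_weak2 {n : ℕ} {ν : Measure (Fin n → ℝ)} (hν : rdfReg ν) {D : ℝ≥0∞}
    (hD : ∀ c r, 0 < r → ν (Metric.closedBall c (5 * r)) ≤ D * ν (Metric.closedBall c r))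
    {f : (Fin n → ℝ) → ℝ≥0∞} (hf : Measurable f) {t : ℝ≥0∞} (ht : t ≠ ⊤) :
    t * ν {x | 2 * t < rdfM ν f x} ≤ D * ∫⁻ x, (if t < f x then f x else 0) ∂ν := by
  refine le_trans ?_ (rdf_weak hν hD _ t)
  refine mul_le_mul_right (measure_mono ?_) _
  intro x hx
  obtain ⟨c, r, hr, hxc, h⟩ := rdf_lt_M.1 hx
  refine rdf_lt_M.2 ⟨c, r, hr, hxc, ?_⟩
  rw [ENNReal.lt_div_iff_mul_lt (Or.inl (hν.pos c r hr)) (Or.inl (hν.fin c r))] at h ⊢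
  have h1 : ∫⁻ y in Metric.closedBall c r, f y ∂ν ≤
      (∫⁻ y in Metric.closedBall c r, (if t < f y then f y else 0) ∂ν)
        + t * ν (Metric.closedBall c r) := by
    rw [← setLIntegral_const, ← lintegral_add_right _ measurable_const]
    refine lintegral_mono fun y => ?_
    dsimp only
    split_ifs with h
    · exact le_self_add
    · simpa using h
  have h2 := h.trans_le h1
  rw [two_mul, add_mul] at h2
  exact lt_of_add_lt_add_right h2

lemma rdf_strong {n : ℕ} {ν : Measure (Fin n → ℝ)} [SFinite ν] (hν : rdfReg ν) {D : ℝ≥0∞}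
    (hD : ∀ c r, 0 < r → ν (Metric.closedBall c (5 * r)) ≤ D * ν (Metric.closedBall c r))
    {q : ℝ} (hq : 1 < q)
    {f : (Fin n → ℝ) → ℝ≥0∞} (hf : Measurable f)  :
    ∫⁻ x, rdfM ν f x ^ q ∂ν ≤
      (ENNReal.ofReal q * (2 * D) * (2 ^ (q-1) / ENNReal.ofReal (q-1))) * ∫⁻ x, f x ^ q ∂ν := by
  have hM := rdf_M_meas hν f
  have hq0 : 0 < q := by linarith
  have hq1 : 0 < q - 1 := by linarith
  have e1 : ∀ x, rdfM ν f x ^ q = ENNReal.ofReal q * ∫⁻ t in Ioi (0:ℝ),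
      (if ENNReal.ofReal t < rdfM ν f x then ENNReal.ofReal (t ^ (q-1)) else 0) := by
    intro x
    rw [rdf_layer hq0, ENNReal.mul_div_cancel (by simpa using hq0) ENNReal.ofReal_ne_top]
  have mpow : ∀ s : ℝ, Measurable (fun t : ℝ => ENNReal.ofReal (t ^ s)) := fun s => by fun_prop
  have m1 : Measurable (Function.uncurry fun (x : Fin n → ℝ) (t : ℝ) =>
      (if ENNReal.ofReal t < rdfM ν f x then ENNReal.ofReal (t ^ (q-1)) else 0)) := by
    refine Measurable.ite (measurableSet_lt ?_ ?_) ?_ measurable_const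
    · exact ENNReal.measurable_ofReal.comp measurable_snd
    · exact hM.comp measurable_fst
    · exact (mpow _).comp measurable_snd
  have m2 : Measurable (Function.uncurry fun (x : Fin n → ℝ) (t : ℝ) =>
      (if ENNReal.ofReal t < 2 * f x then f x * ENNReal.ofReal (t ^ (q-1-1)) else 0)) := by
    refine Measurable.ite (measurableSet_lt ?_ ?_) ?_ measurable_const
    · exact ENNReal.measurable_ofReal.comp measurable_snd
    · exact (hf.comp measurable_fst).const_mul 2
    · exact (hf.comp measurable_fst).mul ((mpow _).comp measurable_snd)
  have step : ∀ t ∈ Ioi (0:ℝ), ∫⁻ x, (if ENNReal.ofReal t < rdfM ν f x then ENNReal.ofReal (t ^ (q-1)) else 0) ∂ν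
      ≤ (2 * D) * ∫⁻ x, (if ENNReal.ofReal t < 2 * f x then f x * ENNReal.ofReal (t ^ (q-1-1)) else 0) ∂ν := by
    intro t ht
    have ht : 0 < t := ht
    have a1 : ∫⁻ x, (if ENNReal.ofReal t < rdfM ν f x then ENNReal.ofReal (t ^ (q-1)) else 0) ∂ν
        = ENNReal.ofReal (t ^ (q-1)) * ν {x | ENNReal.ofReal t < rdfM ν f x} := by
      rw [← lintegral_indicator_const (rdf_M_isOpen hν f _).measurableSet]
      congr 1
      ext x
      simp only [indicator, mem_setOf_eq]
    have hs : 2 * ENNReal.ofReal (t/2) = ENNReal.ofReal t := by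
      rw [← ENNReal.ofReal_ofNat 2, ← ENNReal.ofReal_mul (by norm_num)]
      congr 1; ring
    have a2 := rdf_weak2 hν hD hf (t := ENNReal.ofReal (t/2)) ENNReal.ofReal_ne_top
    rw [hs] at a2
    have a3 : ENNReal.ofReal (t ^ (q-1)) = ENNReal.ofReal (t ^ (q-1-1)) * (2 * ENNReal.ofReal (t/2)) := by
      rw [hs, ← ENNReal.ofReal_mul (Real.rpow_nonneg ht.le _), ← Real.rpow_add_one ht.ne', sub_add_cancel]
    have a4 : ∀ x, (ENNReal.ofReal (t/2) < f x ↔ ENNReal.ofReal t < 2 * f x) := by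
      intro x
      rw [← hs]
      exact (ENNReal.mul_lt_mul_iff_right (by simp) (by simp)).symm
    rw [a1, a3]
    calc ENNReal.ofReal (t ^ (q-1-1)) * (2 * ENNReal.ofReal (t/2)) * ν {x | ENNReal.ofReal t < rdfM ν f x}
        = ENNReal.ofReal (t ^ (q-1-1)) * 2 * (ENNReal.ofReal (t/2) * ν {x | ENNReal.ofReal t < rdfM ν f x}) := by ring
      _ ≤ ENNReal.ofReal (t ^ (q-1-1)) * 2 * (D * ∫⁻ x, (if ENNReal.ofReal (t/2) < f x then f x else 0) ∂ν) := by
          gcongr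
      _ = (2 * D) * (ENNReal.ofReal (t ^ (q-1-1)) * ∫⁻ x, (if ENNReal.ofReal (t/2) < f x then f x else 0) ∂ν) := by ring
      _ = _ := by
          rw [← lintegral_const_mul' _ _ ENNReal.ofReal_ne_top]
          congr 1
          refine lintegral_congr fun x => ?_
          simp only [a4]
          split_ifs
          · ring
          · simp
  calc ∫⁻ x, rdfM ν f x ^ q ∂ν
      = ENNReal.ofReal q * ∫⁻ x, (∫⁻ t in Ioi (0:ℝ),
      (if ENNReal.ofReal t < rdfM ν f x then ENNReal.ofReal (t ^ (q-1)) else 0)) ∂ν := by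
        simp_rw [e1]
        rw [lintegral_const_mul' _ _ ENNReal.ofReal_ne_top]
    _ = ENNReal.ofReal q * ∫⁻ t in Ioi (0:ℝ), (∫⁻ x,
      (if ENNReal.ofReal t < rdfM ν f x then ENNReal.ofReal (t ^ (q-1)) else 0) ∂ν) := by
        rw [lintegral_lintegral_swap m1.aemeasurable]
    _ ≤ ENNReal.ofReal q * ∫⁻ t in Ioi (0:ℝ), (2 * D) * ∫⁻ x, (if ENNReal.ofReal t < 2 * f x then f x * ENNReal.ofReal (t ^ (q-1-1)) else 0) ∂ν := by
        refine mul_le_mul_right ?_ _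
        exact setLIntegral_mono' measurableSet_Ioi step
    _ = ENNReal.ofReal q * (2 * D) * ∫⁻ t in Ioi (0:ℝ), (∫⁻ x, (if ENNReal.ofReal t < 2 * f x then f x * ENNReal.ofReal (t ^ (q-1-1)) else 0) ∂ν) := by
        rw [lintegral_const_mul _ (by
          have := m2.comp measurable_swap
          exact Measurable.lintegral_prod_right' this), ← mul_assoc]
    _ = ENNReal.ofReal q * (2 * D) * ∫⁻ x, (∫⁻ t in Ioi (0:ℝ), (if ENNReal.ofReal t < 2 * f x then f x * ENNReal.ofReal (t ^ (q-1-1)) else 0)) ∂ν := by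
        rw [lintegral_lintegral_swap m2.aemeasurable]
    _ = ENNReal.ofReal q * (2 * D) * ∫⁻ x, (2 ^ (q-1) / ENNReal.ofReal (q-1)) * f x ^ q ∂ν := by
        congr 1
        refine lintegral_congr fun x => ?_
        have : ∀ t : ℝ, (if ENNReal.ofReal t < 2 * f x then f x * ENNReal.ofReal (t ^ (q-1-1)) else 0)
          = f x * (if ENNReal.ofReal t < 2 * f x then ENNReal.ofReal (t ^ (q-1-1)) else 0) := by
          intro t; split_ifs <;> simp
        simp_rw [this]
        rw [lintegral_const_mul, rdf_layer hq1, ENNReal.mul_rpow_of_nonneg _ _ hq1.le]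
        · have : f x ^ q = f x ^ (q-1) * f x := by
            conv_rhs => rw [← ENNReal.rpow_one (f x), ← ENNReal.rpow_mul, one_mul]
            rw [← ENNReal.rpow_add_of_nonneg _ _ hq1.le zero_le_one, sub_add_cancel]
          rw [this, ENNReal.div_eq_inv_mul, ENNReal.div_eq_inv_mul]
          ring
        · exact Measurable.ite (measurableSet_lt ENNReal.measurable_ofReal measurable_const) (mpow _) measurable_const
    _ = _ := by
        rw [lintegral_const_mul _ (hf.pow_const q), ← mul_assoc]
end

noncomputable section

structure rdfGood {n : ℕ} (p : ℝ) (T : ℝ≥0∞) (w : (Fin n → ℝ) → ℝ≥0∞) : Prop where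
  meas : Measurable w
  pos : ∀ᵐ x ∂(volume : Measure (Fin n → ℝ)), w x ≠ 0
  fin : ∀ᵐ x ∂(volume : Measure (Fin n → ℝ)), w x ≠ ⊤
  int : ∀ (c : Fin n → ℝ) (r : ℝ), 0 < r → ∫⁻ x in Metric.closedBall c r, w x ≠ ⊤
  int' : ∀ (c : Fin n → ℝ) (r : ℝ), 0 < r →
    ∫⁻ x in Metric.closedBall c r, w x ^ (-1 / (p - 1)) ≠ ⊤
  ap : ∀ (c : Fin n → ℝ) (r : ℝ), 0 < r → (∫⁻ x in Metric.closedBall c r, w x) *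
    (∫⁻ x in Metric.closedBall c r, w x ^ (-1 / (p - 1))) ^ (p - 1)
      ≤ T * volume (Metric.closedBall c r) ^ p

lemma rdf_holder_set {n : ℕ} {p : ℝ} (hp : 1 < p) {w : (Fin n → ℝ) → ℝ≥0∞} (hw : Measurable w)
    (h0 : ∀ᵐ x ∂(volume : Measure (Fin n → ℝ)), w x ≠ 0)
    (h1 : ∀ᵐ x ∂(volume : Measure (Fin n → ℝ)), w x ≠ ⊤) (E : Set (Fin n → ℝ)) :
    volume E ^ p ≤ (∫⁻ x in E, w x) * (∫⁻ x in E, w x ^ (-1 / (p - 1))) ^ (p - 1) := by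
  have hp0 : 0 < p := by linarith
  have hp1 : 0 < p - 1 := by linarith
  have hc := Real.HolderConjugate.conjExponent hp
  have e1 : volume E = ∫⁻ x in E, ((fun x => w x ^ (1/p)) * (fun x => w x ^ (-1/p))) x := by
    rw [← setLIntegral_one]
    refine lintegral_congr_ae ?_
    filter_upwards [ae_restrict_of_ae h0, ae_restrict_of_ae h1] with x hx0 hx1
    simp only [Pi.mul_apply]
    rw [← ENNReal.rpow_add _ _ hx0 hx1]
    have : 1/p + -1/p = 0 := by ring
    rw [this, ENNReal.rpow_zero]
  have e2 := ENNReal.lintegral_mul_le_Lp_mul_Lq (volume.restrict E) hc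
    (f := fun x => w x ^ (1/p)) (g := fun x => w x ^ (-1/p))
    (hw.pow_const _).aemeasurable (hw.pow_const _).aemeasurable
  rw [← e1] at e2
  simp_rw [← ENNReal.rpow_mul] at e2
  have a1 : 1/p*p = 1 := by field_simp
  have a2 : -1/p * p.conjExponent = -1/(p-1) := by
    unfold Real.conjExponent; field_simp
  rw [a1, a2] at e2
  simp only [ENNReal.rpow_one] at e2
  calc volume E ^ p ≤ _ := ENNReal.rpow_le_rpow e2 hp0.le
    _ = _ := by
      rw [ENNReal.mul_rpow_of_nonneg _ _ hp0.le, ← ENNReal.rpow_mul, ← ENNReal.rpow_mul, a1,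
        ENNReal.rpow_one]
      congr 2
      unfold Real.conjExponent; field_simp

lemma rdfGood.dual {n : ℕ} {p : ℝ} (hp : 1 < p) {T : ℝ≥0∞} {w : (Fin n → ℝ) → ℝ≥0∞}
    (h : rdfGood p T w) :
    rdfGood (p/(p-1)) (T ^ (1/(p-1))) (fun x => w x ^ (-1 / (p - 1))) := by
  have hp1 : 0 < p - 1 := by linarith
  have a1 : p/(p-1) - 1 = 1/(p-1) := by field_simp; ring
  have a2 : ∀ x, (w x ^ (-1 / (p - 1))) ^ (-1 / (p/(p-1) - 1)) = w x := by
    intro x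
    rw [← ENNReal.rpow_mul, a1]
    have : -1 / (p - 1) * (-1 / (1 / (p - 1))) = 1 := by field_simp
    rw [this, ENNReal.rpow_one]
  refine ⟨h.meas.pow_const _, ?_, ?_, h.int', ?_, ?_⟩
  · filter_upwards [h.pos, h.fin] with x h0 h1
    exact (ENNReal.rpow_pos (pos_iff_ne_zero.2 h0) h1).ne'
  · filter_upwards [h.pos, h.fin] with x h0 h1
    exact ENNReal.rpow_ne_top_of_ne_zero h0 h1
  · simp_rw [a2]; exact h.int
  · intro c r hr
    simp_rw [a2]
    rw [a1]
    have := ENNReal.rpow_le_rpow (h.ap c r hr) (z := 1/(p-1)) (by positivity)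
    rw [ENNReal.mul_rpow_of_nonneg _ _ (by positivity), ENNReal.mul_rpow_of_nonneg _ _ (by positivity),
      ← ENNReal.rpow_mul, ← ENNReal.rpow_mul, mul_one_div_cancel hp1.ne', ENNReal.rpow_one,
      mul_one_div, mul_comm] at this
    exact this

lemma rdfGood.intpos {n : ℕ} {p : ℝ} {T : ℝ≥0∞} {w : (Fin n → ℝ) → ℝ≥0∞}
    (h : rdfGood p T w) (c : Fin n → ℝ) (r : ℝ) (hr : 0 < r) :
    ∫⁻ x in Metric.closedBall c r, w x ≠ 0 := by
  intro h0
  rw [lintegral_eq_zero_iff h.meas] at h0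
  have h1 := ae_restrict_of_ae (s := Metric.closedBall c r) h.pos
  have h2 : ∀ᵐ x ∂(volume.restrict (Metric.closedBall c r)), False := by
    filter_upwards [h0, h1] with x a b using b a
  rw [Filter.eventually_false_iff_eq_bot, ae_eq_bot, Measure.restrict_eq_zero] at h2
  exact rdf_reg_volume.pos c r hr h2

lemma rdf_vol5 {n : ℕ} (c : Fin n → ℝ) (r : ℝ) (hr : 0 < r) :
    volume (Metric.closedBall c (5 * r)) = 5 ^ n * volume (Metric.closedBall c r) := by
  rw [Real.volume_pi_closedBall _ (by positivity), Real.volume_pi_closedBall _ hr.le,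
    ← ENNReal.ofReal_ofNat 5, ← ENNReal.ofReal_pow (by norm_num), ← ENNReal.ofReal_mul (by positivity)]
  congr 1
  rw [Fintype.card_fin, ← mul_pow]; congr 1; ring

lemma rdfGood.doubling {n : ℕ} {p : ℝ} (hp : 1 < p) {T : ℝ≥0∞} {w : (Fin n → ℝ) → ℝ≥0∞}
    (h : rdfGood p T w) (c : Fin n → ℝ) (r : ℝ) (hr : 0 < r) :
    ∫⁻ x in Metric.closedBall c (5*r), w x ≤ (T * (5 ^ n) ^ p) * ∫⁻ x in Metric.closedBall c r, w x := by
  have hp1 : 0 < p - 1 := by linarith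
  have hp0 : 0 < p := by linarith
  have h5 : 0 < 5 * r := by linarith
  set m := volume (Metric.closedBall c r) with hm
  have hm0 : m ≠ 0 := rdf_reg_volume.pos c r hr
  have hmt : m ≠ ⊤ := rdf_reg_volume.fin c r
  have e1 := rdf_holder_set hp h.meas h.pos h.fin (Metric.closedBall c r)
  have e2 := h.ap c (5*r) h5
  rw [rdf_vol5 c r hr] at e2
  have e3 : ∫⁻ x in Metric.closedBall c r, w x ^ (-1 / (p - 1)) ≤
      ∫⁻ x in Metric.closedBall c (5*r), w x ^ (-1 / (p - 1)) :=
    lintegral_mono_set (Metric.closedBall_subset_closedBall (by linarith))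
  set W5 := ∫⁻ x in Metric.closedBall c (5*r), w x
  set W1 := ∫⁻ x in Metric.closedBall c r, w x
  set S5 := ∫⁻ x in Metric.closedBall c (5*r), w x ^ (-1 / (p - 1))
  set S1 := ∫⁻ x in Metric.closedBall c r, w x ^ (-1 / (p - 1))
  rw [ENNReal.mul_rpow_of_nonneg _ _ hp0.le] at e2
  have hmp0 : m ^ p ≠ 0 := (ENNReal.rpow_pos (pos_iff_ne_zero.2 hm0) hmt).ne'
  have hmpt : m ^ p ≠ ⊤ := ENNReal.rpow_ne_top_of_nonneg hp0.le hmt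
  rw [← ENNReal.mul_le_mul_iff_right hmp0 hmpt]
  calc m ^ p * W5 ≤ (W1 * S5 ^ (p-1)) * W5 := by
        gcongr
        exact e1.trans (by gcongr)
    _ = W1 * (W5 * S5 ^ (p-1)) := by ring
    _ ≤ W1 * (T * ((5 ^ n) ^ p * m ^ p)) := by gcongr
    _ = _ := by ring

lemma rdfGood.reg {n : ℕ} {p : ℝ} {T : ℝ≥0∞} {w : (Fin n → ℝ) → ℝ≥0∞}
    (h : rdfGood p T w) : rdfReg (volume.withDensity w) where
  pos c r hr := by
    rw [withDensity_apply _ Metric.isClosed_closedBall.measurableSet]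
    exact h.intpos c r hr
  fin c r := by
    rw [withDensity_apply _ Metric.isClosed_closedBall.measurableSet]
    refine ne_top_of_le_ne_top (h.int c (max r 1) (by positivity)) ?_
    exact lintegral_mono_set (Metric.closedBall_subset_closedBall (le_max_left _ _))

lemma rdfGood.strong {n : ℕ} {p : ℝ} (hp : 1 < p) {T : ℝ≥0∞} {w : (Fin n → ℝ) → ℝ≥0∞}
    (h : rdfGood p T w) {q : ℝ} (hq : 1 < q) {f : (Fin n → ℝ) → ℝ≥0∞} (hf : Measurable f) :
    ∫⁻ x, w x * rdfM (volume.withDensity w) f x ^ q ≤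
      (ENNReal.ofReal q * (2 * (T * (5 ^ n) ^ p)) * (2 ^ (q-1) / ENNReal.ofReal (q-1))) *
        ∫⁻ x, w x * f x ^ q := by
  have := rdf_strong (ν := volume.withDensity w) h.reg (D := T * (5 ^ n) ^ p) (by
    intro c r hr
    rw [withDensity_apply _ Metric.isClosed_closedBall.measurableSet,
      withDensity_apply _ Metric.isClosed_closedBall.measurableSet]
    exact h.doubling hp c r hr) hq hf
  rw [lintegral_withDensity_eq_lintegral_mul _ h.meas ((rdf_M_meas h.reg f).pow_const q),
    lintegral_withDensity_eq_lintegral_mul _ h.meas (hf.pow_const q)] at this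
  exact this

lemma rdfGood.pointwise {n : ℕ} {p : ℝ} (hp : 1 < p) {T : ℝ≥0∞} {w : (Fin n → ℝ) → ℝ≥0∞}
    (h : rdfGood p T w) {f : (Fin n → ℝ) → ℝ≥0∞} (hf : Measurable f) (x : Fin n → ℝ) :
    maxOp f x ^ (p-1) ≤ T * rdfM (volume.withDensity w) (fun y =>
      (w y)⁻¹ * rdfM (volume.withDensity fun y => w y ^ (-1 / (p - 1)))
        (fun z => (w z ^ (-1 / (p - 1)))⁻¹ * f z) y ^ (p-1)) x := by
  have hp1 : 0 < p - 1 := by linarith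
  have hd := h.dual hp
  set σ : (Fin n → ℝ) → ℝ≥0∞ := fun y => w y ^ (-1 / (p - 1)) with hσ
  set G := rdfM (volume.withDensity σ) (fun z => (σ z)⁻¹ * f z) with hG
  have hGm : Measurable G := rdf_M_meas hd.reg _
  rw [rdf_maxOp_eq]
  rw [← ENNReal.le_rpow_inv_iff hp1]
  unfold rdfM
  refine iSup_le fun c => iSup_le fun r => iSup_le fun hr => iSup_le fun hx => ?_
  rw [ENNReal.le_rpow_inv_iff hp1]
  refine le_trans ?_ (mul_le_mul_right (rdf_le_M (volume.withDensity w)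
    (fun y => (w y)⁻¹ * G y ^ (p-1)) hr hx) T)
  have hB : MeasurableSet (Metric.closedBall c r) := Metric.isClosed_closedBall.measurableSet
  have hm0 := rdf_reg_volume.pos c r hr
  have hmt := rdf_reg_volume.fin c r
  have hW0 := h.intpos c r hr
  have hWt := h.int c r hr
  have hS0 := hd.intpos c r hr
  have hSt := hd.int c r hr
  have hap := h.ap c r hr
  have hA : ∫⁻ y in Metric.closedBall c r, (σ y)⁻¹ * f y ∂(volume.withDensity σ)
      = ∫⁻ y in Metric.closedBall c r, f y := by
    have mm : Measurable (fun y => (σ y)⁻¹ * f y) := hd.meas.inv.mul hf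
    rw [restrict_withDensity hB, lintegral_withDensity_eq_lintegral_mul _ hd.meas mm]
    refine lintegral_congr_ae ?_
    filter_upwards [ae_restrict_of_ae hd.pos, ae_restrict_of_ae hd.fin] with y h0 h1
    simp only [Pi.mul_apply]
    rw [← mul_assoc, ENNReal.mul_inv_cancel h0 h1, one_mul]
  have hA2 : ∫⁻ y in Metric.closedBall c r, (w y)⁻¹ * G y ^ (p-1) ∂(volume.withDensity w)
      = ∫⁻ y in Metric.closedBall c r, G y ^ (p-1) := by
    have mm : Measurable (fun y => (w y)⁻¹ * G y ^ (p-1)) := h.meas.inv.mul (hGm.pow_const _)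
    rw [restrict_withDensity hB, lintegral_withDensity_eq_lintegral_mul _ h.meas mm]
    refine lintegral_congr_ae ?_
    filter_upwards [ae_restrict_of_ae h.pos, ae_restrict_of_ae h.fin] with y h0 h1
    simp only [Pi.mul_apply]
    rw [← mul_assoc, ENNReal.mul_inv_cancel h0 h1, one_mul]
  have hGle : ∀ y ∈ Metric.closedBall c r,
      ((∫⁻ y in Metric.closedBall c r, f y) / ∫⁻ y in Metric.closedBall c r, σ y) ^ (p-1) ≤ G y ^ (p-1) := by
    intro y hy
    refine ENNReal.rpow_le_rpow ?_ hp1.le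
    have := rdf_le_M (volume.withDensity σ) (fun z => (σ z)⁻¹ * f z) hr hy
    rwa [hA, withDensity_apply _ hB] at this
  have hInt : volume (Metric.closedBall c r) *
      ((∫⁻ y in Metric.closedBall c r, f y) / ∫⁻ y in Metric.closedBall c r, σ y) ^ (p-1) ≤
      ∫⁻ y in Metric.closedBall c r, G y ^ (p-1) := by
    rw [mul_comm, ← setLIntegral_const]
    exact setLIntegral_mono' hB hGle
  rw [hA2, withDensity_apply _ hB]
  refine le_trans ?_ (mul_le_mul_right (ENNReal.div_le_div_right hInt _) T)
  change _ * (∫⁻ y in Metric.closedBall c r, σ y) ^ (p-1) ≤ _ at hap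
  set A := ∫⁻ y in Metric.closedBall c r, f y
  set S := ∫⁻ y in Metric.closedBall c r, σ y
  set W := ∫⁻ y in Metric.closedBall c r, w y
  set m := volume (Metric.closedBall c r)
  have k1 : A / m = (A / S) * (S / m) := by
    rw [div_eq_mul_inv, div_eq_mul_inv, div_eq_mul_inv]
    calc A * m⁻¹ = A * (S⁻¹ * S) * m⁻¹ := by rw [ENNReal.inv_mul_cancel hS0 hSt, mul_one]
      _ = _ := by ring
  have k2 : S ^ (p-1) ≤ T * m ^ p / W := by
    rw [ENNReal.le_div_iff_mul_le (Or.inl hW0) (Or.inl hWt), mul_comm]; exact hap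
  have k3 : m ^ p = m * m ^ (p-1) := by
    conv_rhs => rw [← ENNReal.rpow_one m, ← ENNReal.rpow_mul, one_mul]
    rw [← ENNReal.rpow_add _ _ hm0 hmt]; congr 1; ring
  have k4 : m ^ (p-1) ≠ 0 := (ENNReal.rpow_pos (pos_iff_ne_zero.2 hm0) hmt).ne'
  have k5 : m ^ (p-1) ≠ ⊤ := ENNReal.rpow_ne_top_of_nonneg hp1.le hmt
  rw [k1, ENNReal.mul_rpow_of_nonneg _ _ hp1.le, ENNReal.div_rpow_of_nonneg S m hp1.le]
  calc (A / S) ^ (p-1) * (S ^ (p-1) / m ^ (p-1))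
      ≤ (A / S) ^ (p-1) * ((T * m ^ p / W) / m ^ (p-1)) := by gcongr
    _ = T * (m * (A / S) ^ (p-1) / W) * (m ^ (p-1) * (m ^ (p-1))⁻¹) := by
        rw [k3]; simp only [div_eq_mul_inv]; ring
    _ = _ := by rw [ENNReal.mul_inv_cancel k4 k5, mul_one]

/-- Muckenhoupt's theorem. -/
lemma rdf_muckenhoupt {n : ℕ} {p : ℝ} (hp : 1 < p) {T : ℝ≥0∞} (hT : T ≠ ⊤) :
    ∃ K : ℝ≥0∞, K ≠ ⊤ ∧ ∀ w : (Fin n → ℝ) → ℝ≥0∞, rdfGood p T w →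
      ∀ f : (Fin n → ℝ) → ℝ≥0∞, Measurable f →
        ∫⁻ x, w x * maxOp f x ^ p ≤ K * ∫⁻ x, w x * f x ^ p := by
  have hp1 : 0 < p - 1 := by linarith
  have hp0 : 0 < p := by linarith
  have hq : 1 < p/(p-1) := by rw [lt_div_iff₀ hp1]; linarith
  have hq0 : 0 < p/(p-1) := by linarith
  set q := p/(p-1) with hqdef
  have hfin : ∀ (T' : ℝ≥0∞) (a b : ℝ), T' ≠ ⊤ → 0 < a → 1 < b →
      (ENNReal.ofReal b * (2 * (T' * (5 ^ n) ^ a)) * (2 ^ (b-1) / ENNReal.ofReal (b-1))) ≠ ⊤ := by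
    intro T' a b hT' ha hb
    refine ENNReal.mul_ne_top (ENNReal.mul_ne_top ENNReal.ofReal_ne_top (ENNReal.mul_ne_top (by simp)
      (ENNReal.mul_ne_top hT' (ENNReal.rpow_ne_top_of_nonneg ha.le (by simp))))) ?_
    refine ENNReal.div_ne_top (ENNReal.rpow_ne_top_of_nonneg (by linarith) (by simp)) ?_
    simpa using hb
  have hT' : T ^ (1/(p-1)) ≠ ⊤ := ENNReal.rpow_ne_top_of_nonneg (by positivity) hT
  refine ⟨T ^ q * ((ENNReal.ofReal q * (2 * (T * (5 ^ n) ^ p)) * (2 ^ (q-1) / ENNReal.ofReal (q-1))) *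
    (ENNReal.ofReal p * (2 * (T ^ (1/(p-1)) * (5 ^ n) ^ q)) * (2 ^ (p-1) / ENNReal.ofReal (p-1)))),
    ENNReal.mul_ne_top (ENNReal.rpow_ne_top_of_nonneg hq0.le hT)
      (ENNReal.mul_ne_top (hfin _ _ _ hT hp0 hq) (hfin _ _ _ hT' hq0 hp)), ?_⟩
  intro w h f hf
  have hd := h.dual hp
  rw [← hqdef] at hd
  have hpt := h.pointwise hp hf
  set C1 := (ENNReal.ofReal q * (2 * (T * (5 ^ n) ^ p)) * (2 ^ (q-1) / ENNReal.ofReal (q-1))) with hC1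
  set C2 := (ENNReal.ofReal p * (2 * (T ^ (1/(p-1)) * (5 ^ n) ^ q)) * (2 ^ (p-1) / ENNReal.ofReal (p-1))) with hC2
  have s2 := hd.strong hq hp (f := (fun z => (w z ^ (-1 / (p - 1)))⁻¹ * f z)) (hd.meas.inv.mul hf)
  rw [← hC2] at s2
  have hGm := rdf_M_meas hd.reg (fun z => (w z ^ (-1 / (p - 1)))⁻¹ * f z)
  set G := rdfM (volume.withDensity fun y => w y ^ (-1 / (p - 1)))
        (fun z => (w z ^ (-1 / (p - 1)))⁻¹ * f z) with hG
  have s1 := h.strong hp hq (f := fun y => (w y)⁻¹ * G y ^ (p-1)) (h.meas.inv.mul (hGm.pow_const _))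
  rw [← hC1] at s1
  have hFm := rdf_M_meas h.reg (fun y => (w y)⁻¹ * G y ^ (p-1))
  have eqp : (p-1) * q = p := by rw [hqdef]; field_simp
  have eq1 : -q + 1 = -1/(p-1) := by rw [hqdef]; field_simp; ring
  have z1 : ∫⁻ x, w x * maxOp f x ^ p ≤ T ^ q * ∫⁻ x, w x * rdfM (volume.withDensity w)
      (fun y => (w y)⁻¹ * G y ^ (p-1)) x ^ q := by
    have mm : Measurable (fun x => w x * rdfM (volume.withDensity w)
      (fun y => (w y)⁻¹ * G y ^ (p-1)) x ^ q) := h.meas.mul (hFm.pow_const q)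
    rw [← lintegral_const_mul _ mm]
    refine lintegral_mono fun x => ?_
    have := ENNReal.rpow_le_rpow (hpt x) hq0.le
    rw [← ENNReal.rpow_mul, eqp, ENNReal.mul_rpow_of_nonneg _ _ hq0.le] at this
    calc w x * maxOp f x ^ p ≤ w x * _ := mul_le_mul_right this _
      _ = _ := by ring
  have z2 : ∫⁻ x, w x * ((w x)⁻¹ * G x ^ (p-1)) ^ q = ∫⁻ x, w x ^ (-1 / (p - 1)) * G x ^ p := by
    refine lintegral_congr_ae ?_
    filter_upwards [h.pos, h.fin] with x h0 h1
    rw [ENNReal.mul_rpow_of_nonneg _ _ hq0.le, ← ENNReal.rpow_mul, eqp, ← eq1,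
      ENNReal.rpow_add _ _ h0 h1, ENNReal.rpow_one, ENNReal.rpow_neg, ENNReal.inv_rpow]
    ring
  have z3 : ∫⁻ x, w x ^ (-1 / (p - 1)) * ((w x ^ (-1 / (p - 1)))⁻¹ * f x) ^ p
      = ∫⁻ x, w x * f x ^ p := by
    refine lintegral_congr_ae ?_
    filter_upwards [h.pos, h.fin] with x h0 h1
    rw [ENNReal.mul_rpow_of_nonneg _ _ hp0.le, ← mul_assoc]
    congr 1
    rw [← ENNReal.rpow_neg, ← ENNReal.rpow_mul, ← ENNReal.rpow_add _ _ h0 h1]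
    have : -1 / (p - 1) + -(-1 / (p - 1)) * p = 1 := by field_simp; ring
    rw [this, ENNReal.rpow_one]
  rw [z3] at s2
  rw [z2] at s1
  calc _ ≤ _ := z1
    _ ≤ T ^ q * (C1 * (C2 * ∫⁻ x, w x * f x ^ p)) :=
      mul_le_mul_right (s1.trans (mul_le_mul_right s2 _)) _
    _ = _ := by ring

lemma rdf_maxOp_meas {n : ℕ} (f : (Fin n → ℝ) → ℝ≥0∞) : Measurable (maxOp f) := by
  rw [rdf_maxOp_eq]; exact rdf_M_meas rdf_reg_volume f

lemma rdf_maxOp_tsum {n : ℕ} (l : ℝ≥0∞) (h : ℕ → (Fin n → ℝ) → ℝ≥0∞) (hm : ∀ k, Measurable (h k))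
    (x : Fin n → ℝ) : maxOp (fun y => ∑' k, l ^ k * h k y) x ≤ ∑' k, l ^ k * maxOp (h k) x := by
  rw [rdf_maxOp_eq]
  unfold rdfM
  refine iSup_le fun c => iSup_le fun r => iSup_le fun hr => iSup_le fun hx => ?_
  rw [lintegral_tsum (fun k => ((hm k).const_mul _).aemeasurable)]
  rw [div_eq_mul_inv, ← ENNReal.tsum_mul_right]
  refine ENNReal.tsum_le_tsum fun k => ?_
  rw [lintegral_const_mul _ (hm k), mul_assoc, rdf_maxOp_eq, ← div_eq_mul_inv]
  exact mul_le_mul_right (rdf_le_M _ _ hr hx) _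

/-- Rubio de Francia algorithm. -/
lemma rdf_algorithm {n : ℕ} {p : ℝ} (hp : 1 < p) {T : ℝ≥0∞} (hT : T ≠ ⊤) :
    ∃ K : ℝ≥0∞, K ≠ ⊤ ∧ 1 ≤ K ∧ ∀ w : (Fin n → ℝ) → ℝ≥0∞, rdfGood p T w →
      ∀ h : (Fin n → ℝ) → ℝ≥0∞, Measurable h →
        ∃ H : (Fin n → ℝ) → ℝ≥0∞, Measurable H ∧ (∀ x, h x ≤ H x) ∧
          (∀ x, maxOp H x ≤ K * H x) ∧ ∫⁻ x, w x * H x ^ p ≤ K * ∫⁻ x, w x * h x ^ p := by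
  have hp0 : 0 < p := by linarith
  obtain ⟨K, hK, hM⟩ := rdf_muckenhoupt (n := n) hp hT
  set L : ℝ≥0∞ := 2 * (1 + K) with hL
  have hLt : L ≠ ⊤ := ENNReal.mul_ne_top (by simp) (by simp [hK])
  have hL0 : L ≠ 0 := by simp [hL]
  have hL1 : 1 ≤ L := by
    rw [hL]; calc (1:ℝ≥0∞) ≤ 1 * (1 + K) := by simp
      _ ≤ _ := by gcongr; norm_num
  refine ⟨2 * L + 2 ^ p * 2, ?_, ?_, ?_⟩
  · exact ENNReal.add_ne_top.2 ⟨ENNReal.mul_ne_top (by simp) hLt, ENNReal.mul_ne_top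
      (ENNReal.rpow_ne_top_of_nonneg hp0.le (by simp)) (by simp)⟩
  · calc (1:ℝ≥0∞) ≤ L := hL1
      _ ≤ L + L := le_self_add
      _ = 2 * L := (two_mul L).symm
      _ ≤ _ := le_self_add
  intro w hw h hh
  let a : ℕ → (Fin n → ℝ) → ℝ≥0∞ := fun k => (fun f => maxOp f)^[k] h
  have ha0 : a 0 = h := rfl
  have has : ∀ k, a (k+1) = maxOp (a k) := fun k => Function.iterate_succ_apply' _ _ _
  have ham : ∀ k, Measurable (a k) := by
    intro k
    cases k with
    | zero => exact hh
    | succ k => rw [has]; exact rdf_maxOp_meas _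
  have hai : ∀ k, ∫⁻ x, w x * a k x ^ p ≤ K ^ k * ∫⁻ x, w x * h x ^ p := by
    intro k
    induction k with
    | zero => simp [ha0]
    | succ k ih =>
      rw [has]
      calc _ ≤ _ := hM w hw _ (ham k)
        _ ≤ K * (K ^ k * ∫⁻ x, w x * h x ^ p) := mul_le_mul_right ih _
        _ = _ := by rw [pow_succ]; ring
  set l : ℝ≥0∞ := (2 * L)⁻¹ with hl
  have h2L0 : 2 * L ≠ 0 := mul_ne_zero (by simp) hL0
  have h2Lt : 2 * L ≠ ⊤ := ENNReal.mul_ne_top (by simp) hLt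
  have hl2 : l = 2⁻¹ * L⁻¹ := by
    rw [hl, ENNReal.mul_inv (by simp) (by simp)]
  have hll : 2 * L * l = 1 := ENNReal.mul_inv_cancel h2L0 h2Lt
  let H : (Fin n → ℝ) → ℝ≥0∞ := fun y => ∑' k, l ^ k * a k y
  have hHm : Measurable H := Measurable.tsum fun k => (ham k).const_mul _
  refine ⟨H, hHm, ?_, ?_, ?_⟩
  · intro x
    have := ENNReal.le_tsum (f := fun k => l ^ k * a k x) 0
    simpa [ha0] using this
  · intro x
    calc maxOp H x ≤ ∑' k, l ^ k * maxOp (a k) x := rdf_maxOp_tsum l a ham x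
      _ = ∑' k, (2 * L) * (l ^ (k+1) * a (k+1) x) := by
          congr 1; ext k
          rw [has, pow_succ]
          calc l ^ k * maxOp (a k) x = (2 * L * l) * (l ^ k * maxOp (a k) x) := by rw [hll, one_mul]
            _ = _ := by ring
      _ = (2 * L) * ∑' k, (l ^ (k+1) * a (k+1) x) := ENNReal.tsum_mul_left
      _ ≤ (2 * L) * H x := by
          refine mul_le_mul_right ?_ _
          exact ENNReal.tsum_comp_le_tsum_of_injective (add_left_injective 1) (fun k => l ^ k * a k x)
      _ ≤ _ := by gcongr; exact le_self_add
  · have hpt : ∀ x, H x ^ p ≤ 2 ^ p * ∑' k, ((L⁻¹) ^ k * a k x) ^ p := by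
      intro x
      set s := ∑' k, ((L⁻¹) ^ k * a k x) ^ p with hs
      have h1 : ∀ k, (L⁻¹) ^ k * a k x ≤ s ^ (1/p) := by
        intro k
        rw [one_div, ENNReal.le_rpow_inv_iff hp0]
        exact ENNReal.le_tsum (f := fun k => ((L⁻¹) ^ k * a k x) ^ p) k
      have h2 : H x ≤ 2 * s ^ (1/p) := by
        calc H x = ∑' k, (2⁻¹) ^ k * ((L⁻¹) ^ k * a k x) := by
              change ∑' k, l ^ k * a k x = _
              congr 1; ext k
              rw [hl2, mul_pow, mul_assoc]
          _ ≤ ∑' k, (2⁻¹) ^ k * s ^ (1/p) := by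
              refine ENNReal.tsum_le_tsum fun k => mul_le_mul_right (h1 k) _
          _ = 2 * s ^ (1/p) := by
              rw [ENNReal.tsum_mul_right, ENNReal.tsum_geometric, ENNReal.one_sub_inv_two, inv_inv]
      calc H x ^ p ≤ (2 * s ^ (1/p)) ^ p := ENNReal.rpow_le_rpow h2 hp0.le
        _ = 2 ^ p * s := by
          rw [ENNReal.mul_rpow_of_nonneg _ _ hp0.le, ← ENNReal.rpow_mul, one_div_mul_cancel hp0.ne',
            ENNReal.rpow_one]
    have hLp : (L⁻¹) ^ p * K ≤ 2⁻¹ := by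
      calc (L⁻¹) ^ p * K ≤ (L⁻¹) * (1 + K) := by
            gcongr
            · calc (L⁻¹) ^ p ≤ (L⁻¹) ^ (1:ℝ) :=
                  ENNReal.rpow_le_rpow_of_exponent_ge (ENNReal.inv_le_one.2 hL1) hp.le
                _ = _ := ENNReal.rpow_one _
            · exact le_add_self
        _ = 2⁻¹ * ((1 + K)⁻¹ * (1 + K)) := by
            rw [hL, ENNReal.mul_inv (by simp) (by simp)]; ring
        _ = 2⁻¹ := by rw [ENNReal.inv_mul_cancel (by simp) (by simp [hK]), mul_one]
    have hterm : ∀ k, ∫⁻ x, w x * ((L⁻¹) ^ k * a k x) ^ p ≤ (2⁻¹) ^ k * ∫⁻ x, w x * h x ^ p := by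
      intro k
      have : ∀ x, w x * ((L⁻¹) ^ k * a k x) ^ p = ((L⁻¹) ^ p) ^ k * (w x * a k x ^ p) := by
        intro x
        rw [ENNReal.mul_rpow_of_nonneg _ _ hp0.le, ← ENNReal.rpow_natCast, ← ENNReal.rpow_natCast,
          ← ENNReal.rpow_mul, ← ENNReal.rpow_mul, mul_comm p]
        ring
      simp_rw [this]
      have mm : Measurable (fun x => w x * a k x ^ p) := hw.meas.mul ((ham k).pow_const p)
      rw [lintegral_const_mul _ mm]
      calc _ ≤ ((L⁻¹) ^ p) ^ k * (K ^ k * ∫⁻ x, w x * h x ^ p) := mul_le_mul_right (hai k) _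
        _ = ((L⁻¹) ^ p * K) ^ k * ∫⁻ x, w x * h x ^ p := by rw [mul_pow]; ring
        _ ≤ _ := by gcongr
    calc ∫⁻ x, w x * H x ^ p ≤ ∫⁻ x, 2 ^ p * ∑' k, w x * ((L⁻¹) ^ k * a k x) ^ p := by
          refine lintegral_mono fun x => ?_
          dsimp only
          rw [ENNReal.tsum_mul_left]
          calc w x * H x ^ p ≤ w x * _ := mul_le_mul_right (hpt x) _
            _ = _ := by ring
      _ = 2 ^ p * ∑' k, ∫⁻ x, w x * ((L⁻¹) ^ k * a k x) ^ p := by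
          rw [lintegral_const_mul, lintegral_tsum]
          · exact fun k => (hw.meas.mul (((ham k).const_mul _).pow_const p)).aemeasurable
          · exact Measurable.tsum fun k => hw.meas.mul (((ham k).const_mul _).pow_const p)
      _ ≤ 2 ^ p * ∑' k, (2⁻¹) ^ k * ∫⁻ x, w x * h x ^ p :=
          mul_le_mul_right (ENNReal.tsum_le_tsum hterm) _
      _ = 2 ^ p * 2 * ∫⁻ x, w x * h x ^ p := by
          rw [ENNReal.tsum_mul_right, ENNReal.tsum_geometric, ENNReal.one_sub_inv_two, inv_inv, mul_assoc]
      _ ≤ _ := by gcongr; exact le_add_self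
end

noncomputable section

lemma rdf_le_apConst {n : ℕ} {p : ℝ} (hp : 1 < p) (w : (Fin n → ℝ) → ℝ≥0∞) (c : Fin n → ℝ)
    (r : ℝ) (hr : 0 < r) :
    cubeAvg w (Metric.closedBall c r) *
      (cubeAvg (fun x => w x ^ (-1 / (p - 1))) (Metric.closedBall c r)) ^ (p - 1) ≤ apConst p w := by
  unfold apConst
  rw [if_neg hp.ne']
  exact le_iSup_of_le _ (le_iSup_of_le ((rdf_cube_iff _).2 ⟨c, r, hr, rfl⟩) le_rfl)

lemma rdf_apConst_le {n : ℕ} {p : ℝ} (hp : 1 < p) (w : (Fin n → ℝ) → ℝ≥0∞) {T : ℝ≥0∞}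
    (h : ∀ (c : Fin n → ℝ) (r : ℝ), 0 < r → cubeAvg w (Metric.closedBall c r) *
      (cubeAvg (fun x => w x ^ (-1 / (p - 1))) (Metric.closedBall c r)) ^ (p - 1) ≤ T) :
    apConst p w ≤ T := by
  unfold apConst
  rw [if_neg hp.ne']
  refine iSup_le fun Q => iSup_le fun hQ => ?_
  obtain ⟨c, r, hr, rfl⟩ := (rdf_cube_iff Q).1 hQ
  exact h c r hr

lemma rdf_exhaust {n : ℕ} {P : (Fin n → ℝ) → Prop} (c : Fin n → ℝ) (r : ℝ)
    (h : ∀ R, r ≤ R → ∀ᵐ x ∂(volume.restrict (Metric.closedBall c R)), P x) :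
    ∀ᵐ x ∂(volume : Measure (Fin n → ℝ)), P x := by
  have h2 : ∀ᵐ x ∂(volume : Measure (Fin n → ℝ)), ∀ k : ℕ, x ∈ Metric.closedBall c (r + k) → P x := by
    rw [ae_all_iff]
    intro k
    exact (ae_restrict_iff' Metric.isClosed_closedBall.measurableSet).1 (h (r + k) (by simp))
  filter_upwards [h2] with x hx
  obtain ⟨k, hk⟩ := exists_nat_ge (dist x c - r)
  exact hx k (by rw [Metric.mem_closedBall]; linarith)

lemma rdf_trichotomy {n : ℕ} {p : ℝ} (hp : 1 < p) {w : (Fin n → ℝ) → ℝ≥0∞} (hw : Measurable w)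
    {T : ℝ≥0∞} (hT : T ≠ ⊤) (h : apConst p w ≤ T) :
    (∀ᵐ x ∂(volume : Measure (Fin n → ℝ)), w x = 0) ∨
    (∀ᵐ x ∂(volume : Measure (Fin n → ℝ)), w x = ⊤) ∨ rdfGood p T w := by
  have hp1 : 0 < p - 1 := by linarith
  have ha : -1 / (p-1) < 0 := div_neg_of_neg_of_pos (by norm_num) hp1
  have hB := fun c r hr => (rdf_le_apConst hp w c r hr).trans h
  have hσ : Measurable (fun x => w x ^ (-1 / (p - 1))) := hw.pow_const _
  unfold cubeAvg at hB
  by_cases h1 : ∃ (c : Fin n → ℝ) (r : ℝ), 0 < r ∧ ∫⁻ x in Metric.closedBall c r, w x = ⊤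
  · right; left
    obtain ⟨c, r, hr, hi⟩ := h1
    refine rdf_exhaust c r fun R hR => ?_
    have hR0 : 0 < R := hr.trans_le hR
    have hi2 : ∫⁻ x in Metric.closedBall c R, w x = ⊤ := by
      rw [eq_top_iff, ← hi]
      exact lintegral_mono_set (Metric.closedBall_subset_closedBall hR)
    have h3 := hB c R hR0
    rw [hi2, ENNReal.top_div_of_ne_top (rdf_reg_volume.fin c R)] at h3
    have h4 : ∫⁻ x in Metric.closedBall c R, w x ^ (-1 / (p - 1)) = 0 := by
      by_contra h5
      have h6 : ((∫⁻ x in Metric.closedBall c R, w x ^ (-1 / (p - 1))) / volume (Metric.closedBall c R)) ^ (p-1) ≠ 0 := by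
        rw [Ne, ENNReal.rpow_eq_zero_iff_of_pos hp1, ENNReal.div_eq_zero_iff]
        exact not_or.2 ⟨h5, rdf_reg_volume.fin c R⟩
      rw [ENNReal.top_mul h6] at h3
      exact hT (top_le_iff.1 h3)
    rw [lintegral_eq_zero_iff hσ] at h4
    filter_upwards [h4] with x hx
    simp only [Pi.zero_apply] at hx
    rw [ENNReal.rpow_eq_zero_iff] at hx
    rcases hx with hx | hx
    · linarith [hx.2]
    · exact hx.1
  by_cases h2 : ∃ (c : Fin n → ℝ) (r : ℝ), 0 < r ∧ ∫⁻ x in Metric.closedBall c r, w x ^ (-1 / (p - 1)) = ⊤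
  · left
    obtain ⟨c, r, hr, hi⟩ := h2
    refine rdf_exhaust c r fun R hR => ?_
    have hR0 : 0 < R := hr.trans_le hR
    have hi2 : ∫⁻ x in Metric.closedBall c R, w x ^ (-1 / (p - 1)) = ⊤ := by
      rw [eq_top_iff, ← hi]
      exact lintegral_mono_set (Metric.closedBall_subset_closedBall hR)
    have h3 := hB c R hR0
    rw [hi2, ENNReal.top_div_of_ne_top (rdf_reg_volume.fin c R), ENNReal.top_rpow_of_pos hp1] at h3
    have h4 : ∫⁻ x in Metric.closedBall c R, w x = 0 := by
      by_contra h5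
      have h6 : ((∫⁻ x in Metric.closedBall c R, w x) / volume (Metric.closedBall c R)) ≠ 0 := by
        rw [Ne, ENNReal.div_eq_zero_iff]
        exact not_or.2 ⟨h5, rdf_reg_volume.fin c R⟩
      rw [ENNReal.mul_top h6] at h3
      exact hT (top_le_iff.1 h3)
    rw [lintegral_eq_zero_iff hw] at h4
    filter_upwards [h4] with x hx using hx
  right; right
  push Not at h1 h2
  refine ⟨hw, ?_, ?_, h1, h2, ?_⟩
  · refine rdf_exhaust 0 1 fun R hR => ?_
    filter_upwards [ae_lt_top hσ (h2 0 R (by linarith))] with x hx h0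
    rw [h0, ENNReal.zero_rpow_of_neg ha] at hx
    exact lt_irrefl _ hx
  · refine rdf_exhaust 0 1 fun R hR => ?_
    filter_upwards [ae_lt_top hw (h1 0 R (by linarith))] with x hx using hx.ne
  · intro c r hr
    have h3 := hB c r hr
    have hm0 := rdf_reg_volume.pos c r hr
    have hmt := rdf_reg_volume.fin c r
    set m := volume (Metric.closedBall c r)
    rw [ENNReal.div_rpow_of_nonneg _ _ hp1.le] at h3
    have k3 : m ^ p = m * m ^ (p-1) := by
      conv_rhs => rw [← ENNReal.rpow_one m, ← ENNReal.rpow_mul, one_mul]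
      rw [← ENNReal.rpow_add _ _ hm0 hmt]; congr 1; ring
    have k4 : m ^ (p-1) ≠ 0 := (ENNReal.rpow_pos (pos_iff_ne_zero.2 hm0) hmt).ne'
    have k5 : m ^ (p-1) ≠ ⊤ := ENNReal.rpow_ne_top_of_nonneg hp1.le hmt
    rw [k3]
    set A := ∫⁻ x in Metric.closedBall c r, w x
    set S := ∫⁻ x in Metric.closedBall c r, w x ^ (-1 / (p - 1))
    calc A * S ^ (p-1) = A * S ^ (p-1) * (m * m⁻¹) * (m ^ (p-1) * (m ^ (p-1))⁻¹) := by
          rw [ENNReal.mul_inv_cancel k4 k5, ENNReal.mul_inv_cancel hm0 hmt, mul_one, mul_one]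
      _ = (A / m * (S ^ (p-1) / m ^ (p-1))) * (m * m ^ (p-1)) := by
          simp only [div_eq_mul_inv]; ring
      _ ≤ _ := by gcongr

lemma rdf_mul_rpow {c : ℝ≥0∞} (hc : c ≠ 0) (hc' : c ≠ ⊤) (v : ℝ≥0∞) (a : ℝ) :
    (c * v) ^ a = c ^ a * v ^ a := by
  rcases le_or_gt 0 a with ha | ha
  · exact ENNReal.mul_rpow_of_nonneg _ _ ha
  · obtain ⟨b, rfl⟩ : ∃ b, a = -b := ⟨-a, by ring⟩
    have hb : 0 < b := by linarith
    have h0 : c ^ b ≠ 0 := (ENNReal.rpow_pos (pos_iff_ne_zero.2 hc) hc').ne'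
    have h1 : c ^ b ≠ ⊤ := ENNReal.rpow_ne_top_of_nonneg hb.le hc'
    rw [ENNReal.rpow_neg, ENNReal.rpow_neg, ENNReal.rpow_neg, ENNReal.mul_rpow_of_nonneg _ _ hb.le,
      ENNReal.mul_inv (Or.inl h0) (Or.inl h1)]

lemma rdf_rpow_anti {a b : ℝ≥0∞} (h : a ≤ b) {z : ℝ} (hz : z ≤ 0) : b ^ z ≤ a ^ z := by
  obtain ⟨s, rfl⟩ : ∃ s, z = -s := ⟨-z, by ring⟩
  rw [ENNReal.rpow_neg, ENNReal.rpow_neg]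
  exact ENNReal.inv_le_inv.2 (ENNReal.rpow_le_rpow h (by linarith))

lemma rdf_cubeAvg_mono {n : ℕ} {u v : (Fin n → ℝ) → ℝ≥0∞} {Q : Set (Fin n → ℝ)}
    (h : ∀ x, u x ≤ v x) : cubeAvg u Q ≤ cubeAvg v Q :=
  ENNReal.div_le_div_right (lintegral_mono h) _

lemma rdf_cubeAvg_smul {n : ℕ} {v : (Fin n → ℝ) → ℝ≥0∞} {Q : Set (Fin n → ℝ)} {c : ℝ≥0∞}
    (hc : c ≠ ⊤) : cubeAvg (fun x => c * v x) Q = c * cubeAvg v Q := by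
  unfold cubeAvg
  rw [lintegral_const_mul' _ _ hc, mul_div_assoc]

lemma rdf_ap_compare {n : ℕ} {p : ℝ} (hp : 1 < p) {u v : (Fin n → ℝ) → ℝ≥0∞} {c : ℝ≥0∞}
    (hc0 : c ≠ 0) (hct : c ≠ ⊤) (h1 : ∀ x, v x ≤ u x) (h2 : ∀ x, u x ≤ c * v x) :
    apConst p u ≤ c * apConst p v ∧ apConst p v ≤ c * apConst p u := by
  have hp1 : 0 < p - 1 := by linarith
  have ha : -1 / (p-1) < 0 := div_neg_of_neg_of_pos (by norm_num) hp1
  constructor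
  · refine rdf_apConst_le hp u fun x r hr => ?_
    calc _ ≤ (c * cubeAvg v (Metric.closedBall x r)) *
        (cubeAvg (fun x => v x ^ (-1 / (p - 1))) (Metric.closedBall x r)) ^ (p - 1) := by
          gcongr
          · rw [← rdf_cubeAvg_smul hct]; exact rdf_cubeAvg_mono h2
          · exact rdf_cubeAvg_mono fun y => rdf_rpow_anti (h1 y) ha.le
      _ = c * (cubeAvg v (Metric.closedBall x r) *
        (cubeAvg (fun x => v x ^ (-1 / (p - 1))) (Metric.closedBall x r)) ^ (p - 1)) := by ring
      _ ≤ _ := mul_le_mul_right (rdf_le_apConst hp v x r hr) _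
  · refine rdf_apConst_le hp v fun x r hr => ?_
    have hd0 : c⁻¹ ≠ 0 := ENNReal.inv_ne_zero.2 hct
    have hdt : c⁻¹ ≠ ⊤ := ENNReal.inv_ne_top.2 hc0
    have h3 : ∀ y, c⁻¹ * u y ≤ v y := by
      intro y
      calc c⁻¹ * u y ≤ c⁻¹ * (c * v y) := mul_le_mul_right (h2 y) _
        _ = v y := by rw [← mul_assoc, ENNReal.inv_mul_cancel hc0 hct, one_mul]
    have hft : (c⁻¹) ^ (-1 / (p - 1)) ≠ ⊤ := ENNReal.rpow_ne_top_of_ne_zero hd0 hdt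
    calc _ ≤ (cubeAvg u (Metric.closedBall x r)) *
        ((c⁻¹) ^ (-1 / (p - 1)) * cubeAvg (fun x => u x ^ (-1 / (p - 1))) (Metric.closedBall x r)) ^ (p - 1) := by
          gcongr
          · exact rdf_cubeAvg_mono h1
          · rw [← rdf_cubeAvg_smul hft]
            refine rdf_cubeAvg_mono fun y => ?_
            rw [← rdf_mul_rpow hd0 hdt]
            exact rdf_rpow_anti (h3 y) ha.le
      _ = c * (cubeAvg u (Metric.closedBall x r) *
        (cubeAvg (fun x => u x ^ (-1 / (p - 1))) (Metric.closedBall x r)) ^ (p - 1)) := by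
          rw [ENNReal.mul_rpow_of_nonneg _ _ hp1.le, ← ENNReal.rpow_mul,
            div_mul_cancel₀ _ hp1.ne', ENNReal.rpow_neg, ENNReal.rpow_one, inv_inv]
          ring
      _ ≤ _ := mul_le_mul_right (rdf_le_apConst hp u x r hr) _

/-- Reverse factorization. -/
lemma rdf_factor {n : ℕ} {p : ℝ} (hp : 1 < p) {H u : (Fin n → ℝ) → ℝ≥0∞}
    {K : ℝ≥0∞} (hK0 : K ≠ 0) (hK : K ≠ ⊤)
    (hH0 : ∀ x, H x ≠ 0) (hu0 : ∀ x, u x ≠ 0)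
    (hHt : ∀ᵐ x ∂(volume : Measure (Fin n → ℝ)), H x ≠ ⊤)
    (hut : ∀ᵐ x ∂(volume : Measure (Fin n → ℝ)), u x ≠ ⊤)
    (hHm : Measurable H) (hum : Measurable u)
    (hMH : ∀ x, maxOp H x ≤ K * H x) (hMu : ∀ x, maxOp u x ≤ K * u x) :
    apConst p (fun x => H x ^ (1 - p) * u x) ≤ K ^ p := by
  have hp1 : 0 < p - 1 := by linarith
  refine rdf_apConst_le hp _ fun c r hr => ?_
  have key : ∀ v : (Fin n → ℝ) → ℝ≥0∞, (∀ x, v x ≠ 0) → (∀ᵐ x ∂(volume : Measure (Fin n → ℝ)), v x ≠ ⊤) →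
      Measurable v → (∀ x, maxOp v x ≤ K * v x) → cubeAvg v (Metric.closedBall c r) ≠ 0 ∧
        cubeAvg v (Metric.closedBall c r) ≠ ⊤ ∧
        ∀ x ∈ Metric.closedBall c r, K⁻¹ * cubeAvg v (Metric.closedBall c r) ≤ v x := by
    intro v h0 ht hm hM
    have hb : ∀ x ∈ Metric.closedBall c r, K⁻¹ * cubeAvg v (Metric.closedBall c r) ≤ v x := by
      intro x hx
      have h1 := (rdf_le_M volume v hr hx)
      rw [← rdf_maxOp_eq] at h1
      calc K⁻¹ * cubeAvg v (Metric.closedBall c r) ≤ K⁻¹ * (K * v x) := mul_le_mul_right (h1.trans (hM x)) _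
        _ = v x := by rw [← mul_assoc, ENNReal.inv_mul_cancel hK0 hK, one_mul]
    refine ⟨?_, ?_, hb⟩
    · intro h
      unfold cubeAvg at h
      rw [ENNReal.div_eq_zero_iff] at h
      rcases h with h | h
      · rw [lintegral_eq_zero_iff hm] at h
        have h2 : ∀ᵐ x ∂(volume.restrict (Metric.closedBall c r)), False := by
          filter_upwards [h] with x hx using h0 x hx
        rw [Filter.eventually_false_iff_eq_bot, ae_eq_bot, Measure.restrict_eq_zero] at h2
        exact rdf_reg_volume.pos c r hr h2
      · exact rdf_reg_volume.fin c r h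
    · intro h
      have h2 : ∀ᵐ x ∂(volume.restrict (Metric.closedBall c r)), False := by
        filter_upwards [ae_restrict_of_ae ht, ae_restrict_mem Metric.isClosed_closedBall.measurableSet] with x hx hxB
        have := hb x hxB
        rw [h, ENNReal.mul_top (ENNReal.inv_ne_zero.2 hK)] at this
        exact hx (top_le_iff.1 this)
      rw [Filter.eventually_false_iff_eq_bot, ae_eq_bot, Measure.restrict_eq_zero] at h2
      exact rdf_reg_volume.pos c r hr h2
  obtain ⟨a0, at', ha⟩ := key H hH0 hHt hHm hMH
  obtain ⟨b0, bt, hb⟩ := key u hu0 hut hum hMu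
  have hB : MeasurableSet (Metric.closedBall c r) := Metric.isClosed_closedBall.measurableSet
  set a := cubeAvg H (Metric.closedBall c r) with hadef
  set b := cubeAvg u (Metric.closedBall c r) with hbdef
  have hKi0 : K⁻¹ ≠ 0 := ENNReal.inv_ne_zero.2 hK
  have hKit : K⁻¹ ≠ ⊤ := ENNReal.inv_ne_top.2 hK0
  have hKa0 : K⁻¹ * a ≠ 0 := mul_ne_zero hKi0 a0
  have hKat : K⁻¹ * a ≠ ⊤ := ENNReal.mul_ne_top hKit at'
  have hKb0 : K⁻¹ * b ≠ 0 := mul_ne_zero hKi0 b0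
  have hKbt : K⁻¹ * b ≠ ⊤ := ENNReal.mul_ne_top hKit bt
  have i1 : cubeAvg (fun x => H x ^ (1 - p) * u x) (Metric.closedBall c r) ≤ (K⁻¹ * a) ^ (1-p) * b := by
    rw [hbdef, ← rdf_cubeAvg_smul (ENNReal.rpow_ne_top_of_ne_zero hKa0 hKat)]
    refine ENNReal.div_le_div_right (setLIntegral_mono' hB fun x hx => ?_) _
    exact mul_le_mul_left (rdf_rpow_anti (ha x hx) (by linarith)) _
  have i2 : cubeAvg (fun x => (H x ^ (1 - p) * u x) ^ (-1 / (p-1))) (Metric.closedBall c r)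
      ≤ (K⁻¹ * b) ^ (-1 / (p-1)) * a := by
    rw [hadef, ← rdf_cubeAvg_smul (ENNReal.rpow_ne_top_of_ne_zero hKb0 hKbt)]
    refine ENNReal.div_le_div_right (lintegral_mono_ae ?_) _
    filter_upwards [ae_restrict_of_ae hHt, ae_restrict_mem hB] with x hx hxB
    rw [rdf_mul_rpow (ENNReal.rpow_pos (pos_iff_ne_zero.2 (hH0 x)) hx).ne'
      (ENNReal.rpow_ne_top_of_ne_zero (hH0 x) hx), ← ENNReal.rpow_mul]
    have : (1 - p) * (-1 / (p-1)) = 1 := by field_simp; ring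
    rw [this, ENNReal.rpow_one, mul_comm]
    refine mul_le_mul_left (rdf_rpow_anti (hb x hxB) ?_) _
    exact (div_neg_of_neg_of_pos (by norm_num) hp1).le
  calc _ ≤ ((K⁻¹ * a) ^ (1-p) * b) * ((K⁻¹ * b) ^ (-1 / (p-1)) * a) ^ (p-1) := by gcongr
    _ = K ^ p * ((a ^ (1-p) * a ^ (p-1)) * (b ^ (-1:ℝ) * b)) := by
        rw [ENNReal.mul_rpow_of_nonneg _ _ hp1.le, ← ENNReal.rpow_mul, div_mul_cancel₀ _ hp1.ne',
          rdf_mul_rpow hKi0 hKit, rdf_mul_rpow hKi0 hKit]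
        have : K ^ p = (K⁻¹) ^ (1-p) * (K⁻¹) ^ (-1:ℝ) := by
          rw [← ENNReal.rpow_add _ _ hKi0 hKit, ENNReal.inv_rpow, ← ENNReal.rpow_neg]
          congr 1; ring
        rw [this]; ring
    _ = K ^ p := by
        rw [← ENNReal.rpow_add _ _ a0 at', ENNReal.rpow_neg_one, ENNReal.inv_mul_cancel b0 bt]
        have : 1 - p + (p-1) = 0 := by ring
        rw [this, ENNReal.rpow_zero, mul_one, mul_one]
    _ ≤ K ^ p := le_rfl

lemma rdf_zero_of_H {n : ℕ} {p : ℝ} (hp : 1 < p) {f g : (Fin n → ℝ) → ℝ≥0∞}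
    (hg : Measurable g) {ψ : ℝ≥0∞ → ℝ≥0∞}
    (H : ∀ w : (Fin n → ℝ) → ℝ≥0∞, Measurable w → apConst p w < ⊤ →
        stNorm p w g ≤ ψ (apConst p w) * stNorm p w f)
    (hf0 : ∀ᵐ x ∂(volume : Measure (Fin n → ℝ)), f x = 0) :
    ∀ᵐ x ∂(volume : Measure (Fin n → ℝ)), g x = 0 := by
  have hp0 : 0 < p := by linarith
  have h1 : apConst p (fun _ : Fin n → ℝ => 1) ≤ 1 := by
    refine rdf_apConst_le hp _ fun c r hr => ?_
    have : cubeAvg (fun _ => 1) (Metric.closedBall c r) = 1 := by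
      unfold cubeAvg
      rw [setLIntegral_one, ENNReal.div_self (rdf_reg_volume.pos c r hr) (rdf_reg_volume.fin c r)]
    simp [this]
  have h2 := H _ measurable_const (h1.trans_lt (by simp))
  have h3 : stNorm p (fun _ => 1) f = 0 := by
    unfold stNorm
    rw [ENNReal.rpow_eq_zero_iff_of_pos (by positivity)]
    have : ∫⁻ x, f x ^ p * 1 = ∫⁻ x : Fin n → ℝ, 0 := by
      refine lintegral_congr_ae ?_
      filter_upwards [hf0] with x hx
      simp [hx, hp0]
    rw [this, lintegral_zero]
  rw [h3, mul_zero, nonpos_iff_eq_zero] at h2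
  unfold stNorm at h2
  rw [ENNReal.rpow_eq_zero_iff_of_pos (by positivity)] at h2
  simp only [mul_one] at h2
  rw [lintegral_eq_zero_iff (hg.pow_const p)] at h2
  filter_upwards [h2] with x hx
  simpa [ENNReal.rpow_eq_zero_iff_of_pos hp0] using hx
end

noncomputable section

/-- The weight modified by a factor `s` on a half space. -/
def rdfTilt {n : ℕ} (i0 : Fin n) (w : (Fin n → ℝ) → ℝ≥0∞) (s : ℝ) (x : Fin n → ℝ) : ℝ≥0∞ :=
  (if 0 < x i0 then ENNReal.ofReal s else 1) * w x

lemma rdf_tilt_meas {n : ℕ} (i0 : Fin n) {w : (Fin n → ℝ) → ℝ≥0∞} (hw : Measurable w) (s : ℝ) :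
    Measurable (rdfTilt i0 w s) := by
  unfold rdfTilt
  refine Measurable.mul ?_ hw
  exact Measurable.ite (measurableSet_lt measurable_const (measurable_pi_apply i0))
    measurable_const measurable_const

lemma rdf_tilt_lower {n : ℕ} (i0 : Fin n) {p : ℝ} (hp : 1 < p) {T : ℝ≥0∞}
    {w : (Fin n → ℝ) → ℝ≥0∞} (h : rdfGood p T w) (s : ℝ) :
    ENNReal.ofReal s * (volume (Metric.closedBall (fun _ : Fin n => (1/2 : ℝ)) (1/4)) ^ p *
      volume (Metric.closedBall (fun _ : Fin n => (-1/2 : ℝ)) (1/4)) ^ p) ≤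
      apConst p (rdfTilt i0 w s) * (T * (volume (Metric.closedBall (0 : Fin n → ℝ) 1) ^ p *
        volume (Metric.closedBall (0 : Fin n → ℝ) 1) ^ p)) := by
  have hp0 : 0 < p := by linarith
  have hp1 : 0 < p - 1 := by linarith
  set Bp := Metric.closedBall (fun _ : Fin n => (1/2 : ℝ)) (1/4)
  set Bm := Metric.closedBall (fun _ : Fin n => (-1/2 : ℝ)) (1/4)
  set Q := Metric.closedBall (0 : Fin n → ℝ) 1
  have hBp : Bp ⊆ Q := by
    refine Metric.closedBall_subset_closedBall' ?_
    have : dist (fun _ : Fin n => (1/2 : ℝ)) 0 ≤ 1/2 := by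
      rw [dist_pi_le_iff (by norm_num)]
      intro b; simp
    linarith
  have hBm : Bm ⊆ Q := by
    refine Metric.closedBall_subset_closedBall' ?_
    have : dist (fun _ : Fin n => (-1/2 : ℝ)) 0 ≤ 1/2 := by
      rw [dist_pi_le_iff (by norm_num)]
      intro b; simp
    linarith
  have hpp : ∀ x ∈ Bp, 0 < x i0 := by
    intro x hx
    have := (dist_le_pi_dist x (fun _ : Fin n => (1/2 : ℝ)) i0).trans (Metric.mem_closedBall.1 hx)
    rw [Real.dist_eq, abs_le] at this
    linarith [this.1]
  have hmm : ∀ x ∈ Bm, ¬ 0 < x i0 := by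
    intro x hx
    have := (dist_le_pi_dist x (fun _ : Fin n => (-1/2 : ℝ)) i0).trans (Metric.mem_closedBall.1 hx)
    rw [Real.dist_eq, abs_le] at this
    linarith [this.2]
  have mBp : MeasurableSet Bp := Metric.isClosed_closedBall.measurableSet
  have mBm : MeasurableSet Bm := Metric.isClosed_closedBall.measurableSet
  have e1 := rdf_holder_set hp h.meas h.pos h.fin Bp
  have e2 := rdf_holder_set hp h.meas h.pos h.fin Bm
  have e3 := h.ap 0 1 one_pos
  have e4 := rdf_le_apConst hp (rdfTilt i0 w s) 0 1 one_pos
  have f1 : ENNReal.ofReal s * ∫⁻ x in Bp, w x ≤ ∫⁻ x in Q, rdfTilt i0 w s x := by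
    calc _ = ∫⁻ x in Bp, rdfTilt i0 w s x := by
          rw [← lintegral_const_mul _ h.meas]
          refine setLIntegral_congr_fun mBp fun x hx => ?_
          simp [rdfTilt, hpp x hx]
      _ ≤ _ := lintegral_mono_set hBp
  have f2 : ∫⁻ x in Bm, w x ^ (-1/(p-1)) ≤ ∫⁻ x in Q, rdfTilt i0 w s x ^ (-1/(p-1)) := by
    calc _ = ∫⁻ x in Bm, rdfTilt i0 w s x ^ (-1/(p-1)) := by
          refine setLIntegral_congr_fun mBm fun x hx => ?_
          simp [rdfTilt, hmm x hx]
      _ ≤ _ := lintegral_mono_set hBm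
  have f3 : ∫⁻ x in Bm, w x ≤ ∫⁻ x in Q, w x := lintegral_mono_set hBm
  have f4 : ∫⁻ x in Bp, w x ^ (-1/(p-1)) ≤ ∫⁻ x in Q, w x ^ (-1/(p-1)) := lintegral_mono_set hBp
  have hV0 : volume Q ≠ 0 := rdf_reg_volume.pos 0 1 one_pos
  have hVt : volume Q ≠ ⊤ := rdf_reg_volume.fin 0 1
  unfold cubeAvg at e4
  change (∫⁻ x in Q, rdfTilt i0 w s x) / volume Q * ((∫⁻ x in Q, rdfTilt i0 w s x ^ (-1/(p-1))) / volume Q) ^ (p-1) ≤ _ at e4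
  change (∫⁻ x in Q, w x) * (∫⁻ x in Q, w x ^ (-1/(p-1))) ^ (p-1) ≤ T * volume Q ^ p at e3
  set a := ∫⁻ x in Bp, w x
  set b := ∫⁻ x in Bp, w x ^ (-1/(p-1))
  set c := ∫⁻ x in Bm, w x
  set d := ∫⁻ x in Bm, w x ^ (-1/(p-1))
  set A := ∫⁻ x in Q, rdfTilt i0 w s x
  set B := ∫⁻ x in Q, rdfTilt i0 w s x ^ (-1/(p-1))
  set V := volume Q
  have e5 : A * B ^ (p-1) ≤ apConst p (rdfTilt i0 w s) * V ^ p := by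
    calc A * B ^ (p-1) = (A / V * (B / V) ^ (p-1)) * V ^ p := by
          have hA : A = A / V * V := (ENNReal.div_mul_cancel hV0 hVt).symm
          have hB : B = B / V * V := (ENNReal.div_mul_cancel hV0 hVt).symm
          have hV : V ^ p = V * V ^ (p-1) := by
            conv_lhs => rw [show p = 1 + (p-1) by ring]
            rw [ENNReal.rpow_add _ _ hV0 hVt, ENNReal.rpow_one]
          conv_lhs => rw [hA, hB]
          rw [ENNReal.mul_rpow_of_nonneg _ _ hp1.le, hV]
          ring
      _ ≤ _ := by gcongr
  calc ENNReal.ofReal s * (volume Bp ^ p * volume Bm ^ p)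
      ≤ ENNReal.ofReal s * ((a * b ^ (p-1)) * (c * d ^ (p-1))) := by gcongr
    _ = ((ENNReal.ofReal s * a) * d ^ (p-1)) * (c * b ^ (p-1)) := by ring
    _ ≤ (A * B ^ (p-1)) * ((∫⁻ x in Q, w x) * (∫⁻ x in Q, w x ^ (-1/(p-1))) ^ (p-1)) :=
        mul_le_mul' (mul_le_mul' f1 (ENNReal.rpow_le_rpow f2 hp1.le))
          (mul_le_mul' f3 (ENNReal.rpow_le_rpow f4 hp1.le))
    _ ≤ (apConst p (rdfTilt i0 w s) * V ^ p) * (T * V ^ p) := mul_le_mul' e5 e3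
    _ = _ := by ring

lemma rdf_tilt_compare {n : ℕ} (i0 : Fin n) {p : ℝ} (hp : 1 < p)
    (w : (Fin n → ℝ) → ℝ≥0∞) {s t : ℝ} (hs : 1 ≤ s) (hst : s ≤ t) :
    apConst p (rdfTilt i0 w t) ≤ ENNReal.ofReal (t/s) * apConst p (rdfTilt i0 w s) ∧
    apConst p (rdfTilt i0 w s) ≤ ENNReal.ofReal (t/s) * apConst p (rdfTilt i0 w t) := by
  have hs0 : 0 < s := by linarith
  have h1 : 1 ≤ t / s := (one_le_div hs0).2 hst
  refine rdf_ap_compare hp ?_ ENNReal.ofReal_ne_top ?_ ?_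
  · simp; positivity
  · intro x
    unfold rdfTilt
    gcongr
    split_ifs
    · exact ENNReal.ofReal_le_ofReal hst
    · exact le_rfl
  · intro x
    unfold rdfTilt
    rw [← mul_assoc]
    gcongr
    split_ifs
    · rw [← ENNReal.ofReal_mul (by positivity)]
      rw [div_mul_cancel₀ _ hs0.ne']
    · rw [mul_one]; exact ENNReal.one_le_ofReal.2 h1

lemma rdf_tilt_one {n : ℕ} (i0 : Fin n) (w : (Fin n → ℝ) → ℝ≥0∞) : rdfTilt i0 w 1 = w := by
  funext x; simp [rdfTilt]

/-- abstract intermediate value step -/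
lemma rdf_ivt {F : ℝ → ℝ≥0∞} {S : ℝ} (hS : 1 ≤ S) {T : ℝ≥0∞} (hT : T ≠ ⊤) (h1 : F 1 ≤ T)
    (h2 : T ≤ F S) (hc : ∀ s t : ℝ, 1 ≤ s → s ≤ t → F t ≤ ENNReal.ofReal (t/s) * F s ∧
      F s ≤ ENNReal.ofReal (t/s) * F t) : ∃ s, 1 ≤ s ∧ s ≤ S ∧ F s = T := by
  have hfin : ∀ s, 1 ≤ s → F s ≠ ⊤ := by
    intro s hs
    exact ne_top_of_le_ne_top (ENNReal.mul_ne_top ENNReal.ofReal_ne_top (ne_top_of_le_ne_top hT h1))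
      (hc 1 s le_rfl hs).1
  have hr : ∀ s t : ℝ, 1 ≤ s → s ≤ t → (F t).toReal ≤ (t/s) * (F s).toReal ∧
      (F s).toReal ≤ (t/s) * (F t).toReal := by
    intro s t hs hst
    have hs0 : 0 < s := by linarith
    have ht0 : 0 < t := by linarith
    obtain ⟨a, b⟩ := hc s t hs hst
    have ts : 0 ≤ t / s := by positivity
    constructor
    · have := ENNReal.toReal_mono (ENNReal.mul_ne_top ENNReal.ofReal_ne_top (hfin s hs)) a
      rwa [ENNReal.toReal_mul, ENNReal.toReal_ofReal ts] at this
    · have := ENNReal.toReal_mono (ENNReal.mul_ne_top ENNReal.ofReal_ne_top (hfin t (hs.trans hst))) b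
      rwa [ENNReal.toReal_mul, ENNReal.toReal_ofReal ts] at this
  set M := S * (F 1).toReal
  have hb : ∀ s, 1 ≤ s → s ≤ S → (F s).toReal ≤ M := by
    intro s hs hsS
    have := (hr 1 s le_rfl hs).1
    rw [div_one] at this
    exact this.trans (mul_le_mul_of_nonneg_right hsS ENNReal.toReal_nonneg)
  have hM0 : 0 ≤ M := mul_nonneg (by linarith) ENNReal.toReal_nonneg
  have key : ∀ s t, 1 ≤ s → s ≤ t → t ≤ S → |(F s).toReal - (F t).toReal| ≤ M * (t - s) := by
    intro s t hs hst htS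
    obtain ⟨a, b⟩ := hr s t hs hst
    have hs0 : 0 < s := by linarith
    have e : t / s - 1 ≤ t - s := by
      rw [div_sub_one hs0.ne', div_le_iff₀ hs0]
      nlinarith
    have e0 : 0 ≤ t / s - 1 := by
      have := (one_le_div hs0).2 hst; linarith
    have A : (t / s - 1) * (F s).toReal ≤ (t - s) * M :=
      mul_le_mul e (hb s hs (hst.trans htS)) ENNReal.toReal_nonneg (by linarith)
    have B : (t / s - 1) * (F t).toReal ≤ (t - s) * M :=
      mul_le_mul e (hb t (hs.trans hst) htS) ENNReal.toReal_nonneg (by linarith)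
    rw [abs_le]; constructor <;> nlinarith
  have hcont : ContinuousOn (fun s => (F s).toReal) (Icc 1 S) := by
    have : LipschitzOnWith (Real.toNNReal M) (fun s => (F s).toReal) (Icc 1 S) := by
      refine LipschitzOnWith.of_dist_le_mul fun s hs t ht => ?_
      rw [Real.coe_toNNReal _ hM0, Real.dist_eq, Real.dist_eq]
      rcases le_total s t with h | h
      · rw [abs_sub_comm s t, abs_of_nonneg (by linarith : 0 ≤ t - s)]
        exact key s t hs.1 h ht.2
      · rw [abs_sub_comm, abs_of_nonneg (by linarith : 0 ≤ s - t)]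
        exact key t s ht.1 h hs.2
    exact this.continuousOn
  have := intermediate_value_Icc hS hcont
  obtain ⟨s, hs, hFs⟩ := this ⟨ENNReal.toReal_mono hT h1, ENNReal.toReal_mono (hfin S hS) h2⟩
  exact ⟨s, hs.1, hs.2, (ENNReal.toReal_eq_toReal_iff' (hfin s hs.1) hT).1 hFs⟩

lemma rdf_stNorm_mono {n : ℕ} {p : ℝ} (hp : 0 < p) {u v : (Fin n → ℝ) → ℝ≥0∞}
    (f : (Fin n → ℝ) → ℝ≥0∞) (h : ∀ x, u x ≤ v x) : stNorm p u f ≤ stNorm p v f := by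
  unfold stNorm
  refine ENNReal.rpow_le_rpow (lintegral_mono fun x => ?_) (by positivity)
  exact mul_le_mul_right (h x) _

lemma rdf_stNorm_smul {n : ℕ} {p : ℝ} (hp : 0 < p) {v : (Fin n → ℝ) → ℝ≥0∞} {c : ℝ≥0∞}
    (hc : c ≠ ⊤) (f : (Fin n → ℝ) → ℝ≥0∞) :
    stNorm p (fun x => c * v x) f = c ^ (1/p) * stNorm p v f := by
  unfold stNorm
  rw [← ENNReal.mul_rpow_of_nonneg _ _ (by positivity), ← lintegral_const_mul' _ _ hc]
  congr 1
  refine lintegral_congr fun x => ?_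
  ring

lemma rdf_psi {n : ℕ} (i0 : Fin n) {p : ℝ} (hp : 1 < p) {f g : (Fin n → ℝ) → ℝ≥0∞}
    {ψ : ℝ≥0∞ → ℝ≥0∞} (hψ : ∀ t, t ≠ ⊤ → ψ t ≠ ⊤)
    (H : ∀ w : (Fin n → ℝ) → ℝ≥0∞, Measurable w → apConst p w < ⊤ →
        stNorm p w g ≤ ψ (apConst p w) * stNorm p w f) {T : ℝ≥0∞} (hT : T ≠ ⊤) :
    ∃ C : ℝ≥0∞, C ≠ ⊤ ∧ ∀ w : (Fin n → ℝ) → ℝ≥0∞, rdfGood p T w → apConst p w ≤ T →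
      stNorm p w g ≤ C * stNorm p w f := by
  have hp0 : 0 < p := by linarith
  set b := volume (Metric.closedBall (fun _ : Fin n => (1/2 : ℝ)) (1/4)) ^ p *
      volume (Metric.closedBall (fun _ : Fin n => (-1/2 : ℝ)) (1/4)) ^ p with hb
  set V := volume (Metric.closedBall (0 : Fin n → ℝ) 1) ^ p *
        volume (Metric.closedBall (0 : Fin n → ℝ) 1) ^ p with hV
  have pw0 : ∀ (c : Fin n → ℝ) r, 0 < r → volume (Metric.closedBall c r) ^ p ≠ 0 := fun c r hr =>
    (ENNReal.rpow_pos (pos_iff_ne_zero.2 (rdf_reg_volume.pos c r hr)) (rdf_reg_volume.fin c r)).ne'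
  have pwt : ∀ (c : Fin n → ℝ) r, volume (Metric.closedBall c r) ^ p ≠ ⊤ := fun c r =>
    ENNReal.rpow_ne_top_of_nonneg hp0.le (rdf_reg_volume.fin c r)
  have hb0 : b ≠ 0 := mul_ne_zero (pw0 _ _ (by norm_num)) (pw0 _ _ (by norm_num))
  have hbt : b ≠ ⊤ := ENNReal.mul_ne_top (pwt _ _) (pwt _ _)
  have hVt : V ≠ ⊤ := ENNReal.mul_ne_top (pwt _ _) (pwt _ _)
  have hV0 : V ≠ 0 := mul_ne_zero (pw0 _ _ (by norm_num)) (pw0 _ _ (by norm_num))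
  have hT1 : T + 1 ≠ ⊤ := by simp [hT]
  set X := (T + 1) * ((T + 1) * V) / b with hX
  have hXt : X ≠ ⊤ := ENNReal.div_ne_top (ENNReal.mul_ne_top hT1 (ENNReal.mul_ne_top hT1 hVt)) hb0
  set S := X.toReal + 1 with hS
  have hS1 : 1 ≤ S := by simp [hS]
  refine ⟨ψ (T+1) * ENNReal.ofReal S ^ (1/p), ENNReal.mul_ne_top (hψ _ hT1)
    (ENNReal.rpow_ne_top_of_nonneg (by positivity) ENNReal.ofReal_ne_top), fun w hw hwT => ?_⟩
  have hlow : T + 1 ≤ apConst p (rdfTilt i0 w S) := by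
    have := rdf_tilt_lower i0 hp hw S
    rw [← hb, ← hV] at this
    have h1 : X ≤ ENNReal.ofReal S := by
      rw [← ENNReal.ofReal_toReal hXt]
      exact ENNReal.ofReal_le_ofReal (by simp [hS])
    have h2 : (T + 1) * ((T + 1) * V) ≤ apConst p (rdfTilt i0 w S) * ((T + 1) * V) :=
      calc _ = X * b := (ENNReal.div_mul_cancel hb0 hbt).symm
        _ ≤ ENNReal.ofReal S * b := by gcongr
        _ ≤ _ := this
        _ ≤ _ := by gcongr; simp
    exact (ENNReal.mul_le_mul_iff_left (mul_ne_zero (by simp) hV0) (ENNReal.mul_ne_top hT1 hVt)).1 h2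
  obtain ⟨s, hs1, hsS, hs⟩ := rdf_ivt (F := fun s => apConst p (rdfTilt i0 w s)) hS1 hT1
    (by simp only [rdf_tilt_one]; exact hwT.trans le_self_add) hlow
    (fun s t h1 h2 => rdf_tilt_compare i0 hp w h1 h2)
  have hH := H (rdfTilt i0 w s) (rdf_tilt_meas i0 hw.meas s) (by
    rw [hs]; exact hT1.lt_top)
  rw [hs] at hH
  have hS0 : ENNReal.ofReal S ≠ ⊤ := ENNReal.ofReal_ne_top
  calc stNorm p w g ≤ stNorm p (rdfTilt i0 w s) g := by
        refine rdf_stNorm_mono hp0 g fun x => ?_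
        unfold rdfTilt
        refine le_mul_of_one_le_left' ?_
        split_ifs
        · exact ENNReal.one_le_ofReal.2 hs1
        · exact le_rfl
    _ ≤ ψ (T+1) * stNorm p (rdfTilt i0 w s) f := hH
    _ ≤ ψ (T+1) * stNorm p (fun x => ENNReal.ofReal S * w x) f := by
        refine mul_le_mul_right (rdf_stNorm_mono hp0 f fun x => ?_) _
        unfold rdfTilt
        refine mul_le_mul_left ?_ _
        split_ifs
        · exact ENNReal.ofReal_le_ofReal hsS
        · exact ENNReal.one_le_ofReal.2 hS1
    _ = _ := by rw [rdf_stNorm_smul hp0 hS0, mul_assoc]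

lemma rdf_pos_of_A1 {n : ℕ} {H : (Fin n → ℝ) → ℝ≥0∞} (hm : Measurable H) {K : ℝ≥0∞}
    (hM : ∀ x, maxOp H x ≤ K * H x) (h0 : ¬ ∀ᵐ x ∂(volume : Measure (Fin n → ℝ)), H x = 0) :
    ∀ x, H x ≠ 0 := by
  intro x hx
  refine h0 (rdf_exhaust x 1 fun R hR => ?_)
  have hR0 : 0 < R := by linarith
  have h1 := rdf_le_M volume H hR0 (Metric.mem_closedBall_self (x := x) hR0.le)
  rw [← rdf_maxOp_eq] at h1
  have h2 := h1.trans (hM x)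
  rw [hx, mul_zero, nonpos_iff_eq_zero, ENNReal.div_eq_zero_iff] at h2
  have h3 := h2.resolve_right (rdf_reg_volume.fin x R)
  rw [lintegral_eq_zero_iff hm] at h3
  exact h3
end

noncomputable section

/-- truncations of `g` -/
def rdfTrunc {n : ℕ} (g : (Fin n → ℝ) → ℝ≥0∞) (k : ℕ) : (Fin n → ℝ) → ℝ≥0∞ :=
  (Metric.closedBall 0 ((k : ℝ) + 1)).indicator (fun x => min (g x) k)

lemma rdf_trunc_meas {n : ℕ} {g : (Fin n → ℝ) → ℝ≥0∞} (hg : Measurable g) (k : ℕ) :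
    Measurable (rdfTrunc g k) :=
  (hg.min measurable_const).indicator Metric.isClosed_closedBall.measurableSet

lemma rdf_trunc_le {n : ℕ} (g : (Fin n → ℝ) → ℝ≥0∞) (k : ℕ) (x : Fin n → ℝ) :
    rdfTrunc g k x ≤ g x := by
  unfold rdfTrunc
  by_cases h : x ∈ Metric.closedBall 0 ((k : ℝ) + 1)
  · rw [indicator_of_mem h]; exact min_le_left _ _
  · rw [indicator_of_notMem h]; simp

lemma rdf_trunc_mono {n : ℕ} (g : (Fin n → ℝ) → ℝ≥0∞) (x : Fin n → ℝ) :
    Monotone (fun k => rdfTrunc g k x) := by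
  intro k l hkl
  have hkl' : (k : ℝ) ≤ l := by exact_mod_cast hkl
  simp only [rdfTrunc]
  by_cases h : x ∈ Metric.closedBall 0 ((k : ℝ) + 1)
  · have h2 : x ∈ Metric.closedBall 0 ((l : ℝ) + 1) :=
      Metric.closedBall_subset_closedBall (by linarith) h
    rw [indicator_of_mem h, indicator_of_mem h2]
    exact min_le_min le_rfl (by exact_mod_cast hkl)
  · rw [indicator_of_notMem h]; simp

lemma rdf_trunc_iSup {n : ℕ} (g : (Fin n → ℝ) → ℝ≥0∞) (x : Fin n → ℝ) :
    ⨆ k, rdfTrunc g k x = g x := by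
  refine le_antisymm (iSup_le fun k => rdf_trunc_le g k x) ?_
  refine le_of_forall_lt fun a ha => ?_
  have hat : a ≠ ⊤ := ha.ne_top
  obtain ⟨k1, hk1⟩ := ENNReal.exists_nat_gt hat
  obtain ⟨k2, hk2⟩ := exists_nat_ge (dist x 0)
  refine lt_of_lt_of_le ?_ (le_iSup _ (max k1 k2))
  have h2 : x ∈ Metric.closedBall 0 (((max k1 k2 : ℕ) : ℝ) + 1) := by
    rw [Metric.mem_closedBall]
    have : (k2 : ℝ) ≤ ((max k1 k2 : ℕ) : ℝ) := by exact_mod_cast le_max_right _ _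
    linarith
  unfold rdfTrunc
  rw [indicator_of_mem h2]
  refine lt_min ha (hk1.trans_le ?_)
  exact_mod_cast le_max_left _ _

lemma rdf_trunc_fin {n : ℕ} {p : ℝ} (hp : 1 < p) {T : ℝ≥0∞} {w : (Fin n → ℝ) → ℝ≥0∞}
    (hw : rdfGood p T w) (g : (Fin n → ℝ) → ℝ≥0∞) (k : ℕ) :
    ∫⁻ x, w x * rdfTrunc g k x ^ p ≠ ⊤ := by
  have hp0 : 0 < p := by linarith
  have hk : (0:ℝ) < (k:ℝ) + 1 := by positivity
  have hkt : (k : ℝ≥0∞) ^ p ≠ ⊤ := ENNReal.rpow_ne_top_of_nonneg hp0.le (by simp)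
  have : ∫⁻ x, w x * rdfTrunc g k x ^ p ≤
      (k : ℝ≥0∞) ^ p * ∫⁻ x in Metric.closedBall 0 ((k : ℝ) + 1), w x := by
    rw [← lintegral_const_mul' _ _ hkt,
      ← lintegral_indicator Metric.isClosed_closedBall.measurableSet]
    refine lintegral_mono fun x => ?_
    unfold rdfTrunc
    by_cases h : x ∈ Metric.closedBall 0 ((k : ℝ) + 1)
    · rw [indicator_of_mem h, indicator_of_mem h, mul_comm]
      refine mul_le_mul_left (ENNReal.rpow_le_rpow (min_le_right _ _) hp0.le) _
    · rw [indicator_of_notMem h, indicator_of_notMem h]; simp [hp0]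
  exact ne_top_of_le_ne_top (ENNReal.mul_ne_top hkt (hw.int 0 _ hk)) this

lemma rdf_stNorm_iSup {n : ℕ} {p : ℝ} (hp : 1 < p) {w : (Fin n → ℝ) → ℝ≥0∞} (hw : Measurable w)
    {g : (Fin n → ℝ) → ℝ≥0∞} (hg : Measurable g) {D : ℝ≥0∞}
    (h : ∀ k, (∫⁻ x, w x * rdfTrunc g k x ^ p) ^ (1/p) ≤ D) : stNorm p w g ≤ D := by
  have hp0 : 0 < p := by linarith
  have e : ∀ x, g x ^ p * w x = ⨆ k, w x * rdfTrunc g k x ^ p := by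
    intro x
    rw [← ENNReal.mul_iSup, mul_comm]
    congr 1
    have := (ENNReal.orderIsoRpow p hp0).map_iSup (fun k => rdfTrunc g k x)
    rw [rdf_trunc_iSup] at this
    exact this
  unfold stNorm
  have e2 : ∫⁻ x, g x ^ p * w x ≤ D ^ p := by
    rw [lintegral_congr e, lintegral_iSup]
    · refine iSup_le fun k => ?_
      have := ENNReal.rpow_le_rpow (h k) hp0.le
      rwa [← ENNReal.rpow_mul, one_div, inv_mul_cancel₀ hp0.ne', ENNReal.rpow_one] at this
    · intro k; exact hw.mul ((rdf_trunc_meas hg k).pow_const p)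
    · intro k l hkl x
      exact mul_le_mul_right (ENNReal.rpow_le_rpow (rdf_trunc_mono g x hkl) hp0.le) _
  calc _ ≤ (D ^ p) ^ (1/p) := ENNReal.rpow_le_rpow e2 (by positivity)
    _ = D := by rw [← ENNReal.rpow_mul, one_div, mul_inv_cancel₀ hp0.ne', ENNReal.rpow_one]

/-- Hölder with weight: `∫ a b ≤ (∫ v a^p)^{1/p} (∫ v^{-1/(p-1)} b^{p/(p-1)})^{(p-1)/p}`. -/
lemma rdf_holder_w {n : ℕ} {p : ℝ} (hp : 1 < p) {v a b : (Fin n → ℝ) → ℝ≥0∞}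
    (hv : Measurable v) (ha : Measurable a) (hb : Measurable b)
    (h0 : ∀ᵐ x ∂(volume : Measure (Fin n → ℝ)), v x ≠ 0)
    (h1 : ∀ᵐ x ∂(volume : Measure (Fin n → ℝ)), v x ≠ ⊤) :
    ∫⁻ x, a x * b x ≤ (∫⁻ x, v x * a x ^ p) ^ (1/p) *
      (∫⁻ x, v x ^ (-1/(p-1)) * b x ^ (p/(p-1))) ^ ((p-1)/p) := by
  have hp0 : 0 < p := by linarith
  have hp1 : 0 < p - 1 := by linarith
  have hc := Real.HolderConjugate.conjExponent hp
  have e1 : ∫⁻ x, a x * b x = ∫⁻ x, ((fun x => v x ^ (1/p) * a x) * (fun x => v x ^ (-1/p) * b x)) x := by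
    refine lintegral_congr_ae ?_
    filter_upwards [h0, h1] with x hx0 hx1
    simp only [Pi.mul_apply]
    rw [mul_mul_mul_comm, ← ENNReal.rpow_add _ _ hx0 hx1]
    have : 1/p + -1/p = 0 := by ring
    rw [this, ENNReal.rpow_zero, one_mul]
  rw [e1]
  refine (ENNReal.lintegral_mul_le_Lp_mul_Lq volume hc ((hv.pow_const _).mul ha).aemeasurable
    ((hv.pow_const _).mul hb).aemeasurable).trans (le_of_eq ?_)
  have c1 : p.conjExponent = p/(p-1) := rfl
  have hq : 0 ≤ p/(p-1) := by positivity
  rw [c1]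
  have e2 : 1 / (p/(p-1)) = (p-1)/p := by rw [one_div_div]
  rw [e2]
  congr 2
  · refine lintegral_congr fun x => ?_
    rw [Pi.mul_apply, ENNReal.mul_rpow_of_nonneg _ _ hp0.le, ← ENNReal.rpow_mul, one_div,
      inv_mul_cancel₀ hp0.ne', ENNReal.rpow_one]
  · refine lintegral_congr fun x => ?_
    rw [Pi.mul_apply, ENNReal.mul_rpow_of_nonneg _ _ hq, ← ENNReal.rpow_mul]
    congr 2
    field_simp

lemma rdf_main {n : ℕ} (i0 : Fin n) {p₀ : ℝ} (hp₀ : 1 < p₀) {f g : (Fin n → ℝ) → ℝ≥0∞}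
    (hf : Measurable f) (hg : Measurable g)
    {ψ : ℝ≥0∞ → ℝ≥0∞} (hψ : ∀ t, t ≠ ⊤ → ψ t ≠ ⊤)
    (H : ∀ w : (Fin n → ℝ) → ℝ≥0∞, Measurable w → apConst p₀ w < ⊤ →
        stNorm p₀ w g ≤ ψ (apConst p₀ w) * stNorm p₀ w f)
    {p : ℝ} (hp : 1 < p) {T : ℝ≥0∞} (hT : T ≠ ⊤) :
    ∃ C : ℝ≥0∞, C ≠ ⊤ ∧ 1 ≤ C ∧ ∀ w : (Fin n → ℝ) → ℝ≥0∞, rdfGood p T w →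
      stNorm p w g ≤ C * stNorm p w f := by
  have hp0 : 0 < p := by linarith
  have hp1 : 0 < p - 1 := by linarith
  have hq1 : 1 < p / (p-1) := by rw [one_lt_div hp1]; linarith
  have hq0 : 0 < p / (p-1) := by positivity
  have hp₀0 : 0 < p₀ := by linarith
  have hp₀1 : 0 < p₀ - 1 := by linarith
  have hT' : T ^ (1/(p-1)) ≠ ⊤ := ENNReal.rpow_ne_top_of_nonneg (by positivity) hT
  obtain ⟨K1, hK1t, hK11, alg1⟩ := rdf_algorithm (n := n) hp hT
  obtain ⟨K2, hK2t, hK21, alg2⟩ := rdf_algorithm (n := n) hq1 hT'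
  set K := K1 + K2 with hK
  have hKt : K ≠ ⊤ := by simp [hK, hK1t, hK2t]
  have hK1 : 1 ≤ K := hK11.trans le_self_add
  have hK0 : K ≠ 0 := (one_pos.trans_le hK1).ne'
  obtain ⟨C0, hC0t, hC0⟩ := rdf_psi i0 hp₀ hψ H (T := K ^ p₀)
    (ENNReal.rpow_ne_top_of_nonneg hp₀0.le hKt)
  refine ⟨(C0 + 1) * K, ENNReal.mul_ne_top (by simp [hC0t]) hKt,
    one_le_mul le_add_self hK1, fun w hw => ?_⟩
  by_cases hf0 : ∀ᵐ x ∂(volume : Measure (Fin n → ℝ)), f x = 0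
  · have hg0 := rdf_zero_of_H hp₀ hg H hf0
    have : stNorm p w g = 0 := by
      unfold stNorm
      rw [ENNReal.rpow_eq_zero_iff_of_pos (by positivity)]
      rw [← lintegral_zero (μ := (volume : Measure (Fin n → ℝ)))]
      refine lintegral_congr_ae ?_
      filter_upwards [hg0] with x hx
      simp [hx, hp0]
    rw [this]; exact zero_le
  have hft0 : ∀ h : (Fin n → ℝ) → ℝ≥0∞, (∫⁻ x, w x * h x ^ p) ^ (1/p) = stNorm p w h := by
    intro h; unfold stNorm; congr 1; exact lintegral_congr fun x => mul_comm _ _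
  by_cases hft : stNorm p w f = ⊤
  · rw [hft, ENNReal.mul_top (mul_ne_zero (by simp) hK0)]; exact le_top
  have hft' : ∫⁻ x, w x * f x ^ p ≠ ⊤ := by
    intro h
    rw [← hft0, h, ENNReal.top_rpow_of_pos (by positivity)] at hft
    exact hft rfl
  obtain ⟨H1, hH1m, hfH1, hMH1, hH1⟩ := alg1 w hw f hf
  have hH10 := rdf_pos_of_A1 hH1m hMH1 (by
    intro h; apply hf0; filter_upwards [h] with x hx
    have := hfH1 x; rw [hx] at this; exact nonpos_iff_eq_zero.1 this)
  have mwH : Measurable (fun x => w x * H1 x ^ p) := hw.meas.mul (hH1m.pow_const _)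
  have hH1t : ∀ᵐ x ∂(volume : Measure (Fin n → ℝ)), H1 x ≠ ⊤ := by
    have := ae_lt_top mwH (ne_top_of_le_ne_top (ENNReal.mul_ne_top hK1t hft') hH1)
    filter_upwards [this, hw.pos] with x hx hw0 hH
    rw [hH, ENNReal.top_rpow_of_pos hp0, ENNReal.mul_top hw0] at hx
    exact lt_irrefl _ hx
  refine rdf_stNorm_iSup hp hw.meas hg fun k => ?_
  set G := rdfTrunc g k with hG
  have hGm : Measurable G := rdf_trunc_meas hg k
  set A := ∫⁻ x, w x * G x ^ p with hA
  have hAt : A ≠ ⊤ := rdf_trunc_fin hp hw g k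
  by_cases hA0 : A = 0
  · rw [hA0, ENNReal.zero_rpow_of_pos (by positivity)]; exact zero_le
  have hGt : ∀ x, G x ≠ ⊤ := by
    intro x
    rw [hG]; unfold rdfTrunc
    by_cases h : x ∈ Metric.closedBall 0 ((k : ℝ) + 1)
    · rw [indicator_of_mem h]; exact ne_top_of_le_ne_top (by simp) (min_le_right _ _)
    · rw [indicator_of_notMem h]; simp
  have mh : Measurable (fun x => G x ^ (p-1) * w x) := (hGm.pow_const _).mul hw.meas
  obtain ⟨u, hum, hhu, hMu, hu⟩ := alg2 _ (hw.dual hp) _ mh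
  have hσA : ∫⁻ x, w x ^ (-1/(p-1)) * (G x ^ (p-1) * w x) ^ (p/(p-1)) = A := by
    refine lintegral_congr_ae ?_
    filter_upwards [hw.pos, hw.fin] with x hx0 hxt
    rw [ENNReal.mul_rpow_of_nonneg _ _ hq0.le, ← ENNReal.rpow_mul, mul_left_comm,
      ← ENNReal.rpow_add _ _ hx0 hxt, mul_div_cancel₀ _ hp1.ne']
    have : -1/(p-1) + p/(p-1) = 1 := by field_simp; ring
    rw [this, ENNReal.rpow_one, mul_comm]
  rw [hσA] at hu
  have hu0 := rdf_pos_of_A1 hum hMu (by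
    intro h; apply hA0
    rw [← hσA, ← lintegral_zero (μ := (volume : Measure (Fin n → ℝ)))]
    refine lintegral_congr_ae ?_
    filter_upwards [h] with x hx
    have := hhu x; rw [hx, nonpos_iff_eq_zero] at this
    rw [this, ENNReal.zero_rpow_of_pos hq0, mul_zero])
  have mσu : Measurable (fun x => w x ^ (-1/(p-1)) * u x ^ (p/(p-1))) :=
    (hw.meas.pow_const _).mul (hum.pow_const _)
  have hut : ∀ᵐ x ∂(volume : Measure (Fin n → ℝ)), u x ≠ ⊤ := by
    have := ae_lt_top mσu (ne_top_of_le_ne_top (ENNReal.mul_ne_top hK2t hAt) hu)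
    filter_upwards [this, (hw.dual hp).pos] with x hx hw0 hH
    rw [hH, ENNReal.top_rpow_of_pos hq0, ENNReal.mul_top hw0] at hx
    exact lt_irrefl _ hx
  -- the weight W
  set W : (Fin n → ℝ) → ℝ≥0∞ := fun x => H1 x ^ (1-p₀) * u x with hW
  have hWm : Measurable W := (hH1m.pow_const _).mul hum
  have hWap : apConst p₀ W ≤ K ^ p₀ := rdf_factor hp₀ hK0 hKt hH10 hu0 hH1t hut hH1m hum
    (fun x => (hMH1 x).trans (by gcongr; exact le_self_add))
    (fun x => (hMu x).trans (by gcongr; exact le_add_self))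
  have hWpos : ∀ᵐ x ∂(volume : Measure (Fin n → ℝ)), W x ≠ 0 ∧ W x ≠ ⊤ := by
    filter_upwards [hH1t, hut] with x h1 h2
    have a1 : H1 x ^ (1-p₀) ≠ 0 := (ENNReal.rpow_pos (pos_iff_ne_zero.2 (hH10 x)) h1).ne'
    have a2 : H1 x ^ (1-p₀) ≠ ⊤ := ENNReal.rpow_ne_top_of_ne_zero (hH10 x) h1
    exact ⟨mul_ne_zero a1 (hu0 x), ENNReal.mul_ne_top a2 h2⟩
  have hWgood : rdfGood p₀ (K ^ p₀) W := by
    have hne : ∀ P : (Fin n → ℝ) → Prop, (∀ᵐ x ∂(volume : Measure (Fin n → ℝ)), P x) → ∃ x, P x :=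
      fun P h => h.exists
    rcases rdf_trichotomy hp₀ hWm (ENNReal.rpow_ne_top_of_nonneg hp₀0.le hKt) hWap with h | h | h
    · obtain ⟨x, a, b⟩ := hne _ (h.and hWpos); exact absurd a b.1
    · obtain ⟨x, a, b⟩ := hne _ (h.and hWpos); exact absurd a b.2
    · exact h
  have step := hC0 W hWgood hWap
  set J := ∫⁻ x, H1 x * u x with hJ
  -- Holder
  have s1 : A ≤ ∫⁻ x, g x * u x := by
    refine lintegral_mono_ae ?_
    filter_upwards with x
    calc w x * G x ^ p = G x * (G x ^ (p-1) * w x) := by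
          have : G x ^ p = G x * G x ^ (p-1) := by
            by_cases h0 : G x = 0
            · rw [h0, ENNReal.zero_rpow_of_pos hp0, zero_mul]
            · conv_lhs => rw [show p = 1 + (p-1) by ring]
              rw [ENNReal.rpow_add _ _ h0 (hGt x), ENNReal.rpow_one]
          rw [this]; ring
      _ ≤ g x * u x := mul_le_mul' (rdf_trunc_le g k x) (hhu x)
  have s2 : ∫⁻ x, g x * u x ≤ stNorm p₀ W g * J ^ ((p₀-1)/p₀) := by
    refine (rdf_holder_w hp₀ hWm hg hum (hWpos.mono fun x h => h.1) (hWpos.mono fun x h => h.2)).trans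
      (le_of_eq ?_)
    unfold stNorm
    congr 2
    · exact lintegral_congr fun x => mul_comm _ _
    · refine lintegral_congr_ae ?_
      filter_upwards [hH1t, hut] with x h1 h2
      have a1 : H1 x ^ (1-p₀) ≠ 0 := (ENNReal.rpow_pos (pos_iff_ne_zero.2 (hH10 x)) h1).ne'
      have a2 : H1 x ^ (1-p₀) ≠ ⊤ := ENNReal.rpow_ne_top_of_ne_zero (hH10 x) h1
      rw [hW]; simp only
      rw [rdf_mul_rpow a1 a2, ← ENNReal.rpow_mul, mul_assoc, ← ENNReal.rpow_add _ _ (hu0 x) h2]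
      have e1 : (1-p₀) * (-1/(p₀-1)) = 1 := by field_simp; ring
      have e2 : -1/(p₀-1) + p₀/(p₀-1) = 1 := by field_simp; ring
      rw [e1, e2, ENNReal.rpow_one, ENNReal.rpow_one]
  have s3 : stNorm p₀ W f ≤ J ^ (1/p₀) := by
    unfold stNorm
    refine ENNReal.rpow_le_rpow (lintegral_mono_ae ?_) (by positivity)
    filter_upwards [hH1t] with x h1
    calc f x ^ p₀ * W x ≤ H1 x ^ p₀ * W x := by
          gcongr; exact hfH1 x
      _ = H1 x * u x := by
          rw [hW]; simp only
          rw [← mul_assoc, ← ENNReal.rpow_add _ _ (hH10 x) h1]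
          have : p₀ + (1-p₀) = 1 := by ring
          rw [this, ENNReal.rpow_one]
  have s4 : J ≤ (K * stNorm p w f) * A ^ ((p-1)/p) := by
    have e1 := rdf_holder_w hp hw.meas hH1m hum hw.pos hw.fin
    calc J ≤ _ := e1
      _ ≤ (K * ∫⁻ x, w x * f x ^ p) ^ (1/p) * (K * A) ^ ((p-1)/p) := by
          refine mul_le_mul' (ENNReal.rpow_le_rpow (hH1.trans ?_) (by positivity))
            (ENNReal.rpow_le_rpow (hu.trans ?_) (by positivity))
          · exact mul_le_mul_left le_self_add _
          · exact mul_le_mul_left le_add_self _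
      _ = (K ^ (1/p) * K ^ ((p-1)/p)) * stNorm p w f * A ^ ((p-1)/p) := by
          rw [ENNReal.mul_rpow_of_nonneg _ _ (by positivity),
            ENNReal.mul_rpow_of_nonneg _ _ (by positivity), hft0]
          ring
      _ = _ := by
          rw [← ENNReal.rpow_add _ _ hK0 hKt]
          have : 1/p + (p-1)/p = 1 := by field_simp; ring
          rw [this, ENNReal.rpow_one]
  have s5 : A ≤ C0 * (K * stNorm p w f) * A ^ ((p-1)/p) := by
    calc A ≤ stNorm p₀ W g * J ^ ((p₀-1)/p₀) := s1.trans s2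
      _ ≤ (C0 * J ^ (1/p₀)) * J ^ ((p₀-1)/p₀) := by
          refine mul_le_mul_left (step.trans (mul_le_mul_right s3 _)) _
      _ = C0 * J := by
          rw [mul_assoc, ← ENNReal.rpow_add_of_nonneg _ _ (by positivity) (by positivity)]
          have : 1/p₀ + (p₀-1)/p₀ = 1 := by field_simp; ring
          rw [this, ENNReal.rpow_one]
      _ ≤ C0 * ((K * stNorm p w f) * A ^ ((p-1)/p)) := mul_le_mul_right s4 _
      _ = _ := by ring
  have hB0 : A ^ ((p-1)/p) ≠ 0 := (ENNReal.rpow_pos (pos_iff_ne_zero.2 hA0) hAt).ne'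
  have hBt : A ^ ((p-1)/p) ≠ ⊤ := ENNReal.rpow_ne_top_of_nonneg (by positivity) hAt
  have hAA : A = A ^ (1/p) * A ^ ((p-1)/p) := by
    rw [← ENNReal.rpow_add _ _ hA0 hAt]
    have : 1/p + (p-1)/p = 1 := by field_simp; ring
    rw [this, ENNReal.rpow_one]
  have s6 : A ^ (1/p) ≤ C0 * (K * stNorm p w f) := by
    refine (ENNReal.mul_le_mul_iff_left hB0 hBt).1 ?_
    rw [← hAA]; exact s5
  calc _ ≤ _ := s6
    _ ≤ (C0 + 1) * (K * stNorm p w f) := mul_le_mul_left le_self_add _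
    _ = _ := by ring

lemma rdf_zero_dim {p₀ : ℝ} (hp₀ : 1 < p₀) {f g : (Fin 0 → ℝ) → ℝ≥0∞}
    {ψ : ℝ≥0∞ → ℝ≥0∞} (hψ : ∀ t, t ≠ ⊤ → ψ t ≠ ⊤)
    (H : ∀ w : (Fin 0 → ℝ) → ℝ≥0∞, Measurable w → apConst p₀ w < ⊤ →
        stNorm p₀ w g ≤ ψ (apConst p₀ w) * stNorm p₀ w f)
    {p : ℝ} (hp : 1 < p) :
    ∃ C : ℝ≥0∞, C ≠ ⊤ ∧ ∀ w : (Fin 0 → ℝ) → ℝ≥0∞, stNorm p w g ≤ C * stNorm p w f := by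
  have hp0 : 0 < p := by linarith
  have hp₀0 : 0 < p₀ := by linarith
  have hst : ∀ (r : ℝ) (_ : 0 < r) (w h : (Fin 0 → ℝ) → ℝ≥0∞),
      stNorm r w h = h default * w default ^ (1/r) := by
    intro r hr w h
    have hv : (volume : Measure (Fin 0 → ℝ)) = Measure.dirac default := by
      rw [volume_pi, Measure.pi_of_empty]
      exact congrArg _ (Subsingleton.elim _ _)
    unfold stNorm
    rw [hv, lintegral_dirac, ENNReal.mul_rpow_of_nonneg _ _ (by positivity), ← ENNReal.rpow_mul,
      one_div, mul_inv_cancel₀ hr.ne', ENNReal.rpow_one]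
  have h1 : apConst p₀ (fun _ : Fin 0 → ℝ => 1) ≤ 1 := by
    refine rdf_apConst_le hp₀ _ fun c r hr => ?_
    have : cubeAvg (fun _ => 1) (Metric.closedBall c r) = 1 := by
      unfold cubeAvg
      rw [setLIntegral_one, ENNReal.div_self (rdf_reg_volume.pos c r hr) (rdf_reg_volume.fin c r)]
    simp [this]
  have hlt : apConst p₀ (fun _ : Fin 0 → ℝ => 1) < ⊤ := h1.trans_lt (by simp)
  have h2 := H _ measurable_const hlt
  rw [hst p₀ hp₀0, hst p₀ hp₀0] at h2
  simp only [ENNReal.one_rpow, mul_one] at h2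
  refine ⟨_, hψ _ hlt.ne, fun w => ?_⟩
  rw [hst p hp0, hst p hp0, ← mul_assoc]
  exact mul_le_mul_left h2 _

theorem stmt14 {n : ℕ} (p₀ : ℝ) (hp₀ : 1 < p₀)
    (f g : (Fin n → ℝ) → ℝ≥0∞) (hf : Measurable f) (hg : Measurable g)
    -- strong-type hypothesis, with constant depending only on ‖w‖_{A_{p₀}}
    (H : ∃ ψ : ℝ≥0∞ → ℝ≥0∞, (∀ t, t ≠ ⊤ → ψ t ≠ ⊤) ∧
      ∀ w : (Fin n → ℝ) → ℝ≥0∞, Measurable w → apConst p₀ w < ⊤ →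
        stNorm p₀ w g ≤ ψ (apConst p₀ w) * stNorm p₀ w f) :
    ∀ p : ℝ, 1 < p → ∃ ψ' : ℝ≥0∞ → ℝ≥0∞, (∀ t, t ≠ ⊤ → ψ' t ≠ ⊤) ∧
      ∀ w : (Fin n → ℝ) → ℝ≥0∞, Measurable w → apConst p w < ⊤ →
        stNorm p w g ≤ ψ' (apConst p w) * stNorm p w f := by
  obtain ⟨ψ, hψ, H⟩ := H
  intro p hp
  have hp0 : 0 < p := by linarith
  rcases Nat.eq_zero_or_pos n with rfl | hn
  · obtain ⟨C, hC, h⟩ := rdf_zero_dim hp₀ hψ H hp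
    exact ⟨fun _ => C, fun _ _ => hC, fun w _ _ => h w⟩
  have i0 : Fin n := ⟨0, hn⟩
  have hmain := fun (T : ℝ≥0∞) (hT : T ≠ ⊤) => rdf_main i0 hp₀ hf hg hψ H hp hT
  choose! C hCt hC1 hC using hmain
  refine ⟨C, hCt, fun w hw hwt => ?_⟩
  have hC0 : C (apConst p w) ≠ 0 := (one_pos.trans_le (hC1 _ hwt.ne)).ne'
  rcases rdf_trichotomy hp hw hwt.ne le_rfl with h | h | h
  · have : stNorm p w g = 0 := by
      unfold stNorm
      rw [ENNReal.rpow_eq_zero_iff_of_pos (by positivity)]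
      rw [← lintegral_zero (μ := (volume : Measure (Fin n → ℝ)))]
      refine lintegral_congr_ae ?_
      filter_upwards [h] with x hx
      simp [hx]
    rw [this]; exact zero_le
  · by_cases hf0 : ∀ᵐ x ∂(volume : Measure (Fin n → ℝ)), f x = 0
    · have hg0 := rdf_zero_of_H hp₀ hg H hf0
      have : stNorm p w g = 0 := by
        unfold stNorm
        rw [ENNReal.rpow_eq_zero_iff_of_pos (by positivity)]
        rw [← lintegral_zero (μ := (volume : Measure (Fin n → ℝ)))]
        refine lintegral_congr_ae ?_
        filter_upwards [hg0] with x hx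
        simp [hx, hp0]
      rw [this]; exact zero_le
    · have : stNorm p w f = ⊤ := by
        by_contra hne
        apply hf0
        have mm : Measurable (fun x => f x ^ p * w x) := (hf.pow_const _).mul hw
        have hi : ∫⁻ x, f x ^ p * w x ≠ ⊤ := by
          intro hh
          unfold stNorm at hne
          rw [hh, ENNReal.top_rpow_of_pos (by positivity)] at hne
          exact hne rfl
        filter_upwards [ae_lt_top mm hi, h] with x hx hwx
        by_contra hfx
        rw [hwx, ENNReal.mul_top] at hx
        · exact lt_irrefl _ hx
        · rw [Ne, ENNReal.rpow_eq_zero_iff_of_pos hp0]; exact hfx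
      rw [this, ENNReal.mul_top hC0]; exact le_top
  · exact hC _ hwt.ne w h
end
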